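/- arXiv:0712.0220 — 3 statements merged into one kernel-verified Lean document; each statement's English description precedes it below -/
import Mathlib

section
/- For every ε > 0 there exists N₀ such that for every odd prime N ≥ N₀, every x ∈ Z_N, and every starting state, the Pollard Rho walk (Y_i)_{i≥0} on Z_N satisfies E[ min{ j ≥ 1 : Y_j ∈ {Y_0, …, Y_{j−1}} } ] ≤ (1+ε)·12·√19·√N; that is, the expected number of steps until the walk revisits a previously visited state is at most (1+o(1))·12√19·√N < (1+o(1))·52.5·√N. -/
open MeasureTheory Finset

universe u

instance (N : ℕ) : MeasurableSpace (ZMod N) := ⊤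

/-- The trajectory `X` is (in law) a Markov chain with transition matrix `P` under the
probability measure `μ`. -/
def IsMarkovTraj {S Ω : Type*} [MeasurableSpace Ω]
    (μ : Measure Ω) (P : Matrix S S ℝ) (X : ℕ → Ω → S) : Prop :=
  ∀ (n : ℕ) (y : ℕ → S),
    (μ {ω | ∀ i ≤ n + 1, X i ω = y i}).toReal
      = P (y n) (y (n + 1)) * (μ {ω | ∀ i ≤ n, X i ω = y i}).toReal

/-- The Pollard Rho walk on `Z_N` with parameter `x`:
`P(u,u+1) = P(u,u+x) = P(u,2u) = 1/3`. -/
noncomputable def rhoMatrix (N : ℕ) (x : ZMod N) : Matrix (ZMod N) (ZMod N) ℝ :=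
  fun u v => (1 / 3 : ℝ) *
    ((if v = u + 1 then 1 else 0) + (if v = u + x then 1 else 0) +
      (if v = 2 * u then 1 else 0))

/-! ### Local estimates -/

section Local

variable {N : ℕ}

lemma sum_even_add_sum_odd {R : Type*} [CommRing R] (F : R → ℝ) (n : ℕ) (z : R) :
    ∑ t ∈ range n, F (z + 2 * t) + ∑ t ∈ range n, F (z + 1 + 2 * t) =
      ∑ t ∈ range (2 * n), F (z + t) := by
  induction n with
  | zero => simp
  | succ n ih =>
    rw [sum_range_succ, sum_range_succ, mul_add, mul_one, sum_range_succ, sum_range_succ, ← ih]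
    push_cast
    rw [show z + 1 + 2 * (n : R) = z + (2 * n + 1) by ring]
    ring

lemma isUnit_two_of_odd (hN : Odd N) : IsUnit (2 : ZMod N) := by
  have := (ZMod.isUnit_iff_coprime 2 N).2 (Nat.coprime_two_left.2 hN)
  simpa using this

lemma natCast_injOn_range {n : ℕ} (hn : n ≤ N) :
    Set.InjOn (Nat.cast : ℕ → ZMod N) (range n : Finset ℕ) := by
  intro a ha b hb h
  have ha' : a < N := (mem_range.1 ha).trans_le hn
  have hb' : b < N := (mem_range.1 hb).trans_le hn
  have := congrArg ZMod.val h
  rwa [ZMod.val_natCast_of_lt ha', ZMod.val_natCast_of_lt hb'] at this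

lemma sum_consecutive_single_le {n : ℕ} (hn : n ≤ N) (v z : ZMod N) :
    ∑ t ∈ range n, (if z + (t : ZMod N) = v then (1 : ℝ) else 0) ≤ 1 := by
  have hinj : Set.InjOn (fun t : ℕ => z + (t : ZMod N)) (range n : Finset ℕ) := by
    intro a ha b hb h
    exact natCast_injOn_range hn ha hb (add_left_cancel h)
  rw [← sum_image (f := fun y => if y = v then (1 : ℝ) else 0) hinj, sum_ite_eq']
  split_ifs <;> simp

/-- `levelGreen N x T s u v` is the expected number of visits to `v` before time `T`, for the walk
started at `u`, at times when exactly `s` doublings have been performed. -/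
noncomputable def levelGreen (N : ℕ) (x : ZMod N) : ℕ → ℕ → ZMod N → ZMod N → ℝ
  | 0, _, _, _ => 0
  | T + 1, 0, u, v =>
    (if u = v then 1 else 0) +
      1 / 3 * (levelGreen N x T 0 (u + 1) v + levelGreen N x T 0 (u + x) v)
  | T + 1, s + 1, u, v =>
    1 / 3 * levelGreen N x T s (2 * u) v +
      1 / 3 * (levelGreen N x T (s + 1) (u + 1) v + levelGreen N x T (s + 1) (u + x) v)

variable {x : ZMod N}

lemma levelGreen_nonneg (T s : ℕ) (u v : ZMod N) : 0 ≤ levelGreen N x T s u v := by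
  induction T generalizing s u v with
  | zero => simp [levelGreen]
  | succ T ih =>
    cases s with
    | zero =>
      have h1 := ih 0 (u + 1) v
      have h2 := ih 0 (u + x) v
      simp only [levelGreen]
      positivity
    | succ s =>
      have h1 := ih (s + 1) (u + 1) v
      have h2 := ih (s + 1) (u + x) v
      have h3 := ih s (2 * u) v
      simp only [levelGreen]
      positivity

lemma levelGreen_le_succ (T s : ℕ) (u v : ZMod N) :
    levelGreen N x T s u v ≤ levelGreen N x (T + 1) s u v := by
  induction T generalizing s u v with
  | zero => exact levelGreen_nonneg 1 s u v
  | succ T ih =>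
    cases s with
    | zero =>
      have h1 := ih 0 (u + 1) v
      have h2 := ih 0 (u + x) v
      rw [levelGreen, levelGreen]
      linarith
    | succ s =>
      have h1 := ih (s + 1) (u + 1) v
      have h2 := ih (s + 1) (u + x) v
      have h3 := ih s (2 * u) v
      rw [levelGreen, levelGreen]
      linarith

lemma levelGreen_zero_le (T : ℕ) (u v : ZMod N) :
    levelGreen N x T 0 u v ≤ (if u = v then 1 else 0) +
      1 / 3 * (levelGreen N x T 0 (u + 1) v + levelGreen N x T 0 (u + x) v) := by
  refine (levelGreen_le_succ T 0 u v).trans (le_of_eq ?_)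
  rw [levelGreen]

lemma levelGreen_succ_le (T s : ℕ) (u v : ZMod N) :
    levelGreen N x T (s + 1) u v ≤ 1 / 3 * levelGreen N x T s (2 * u) v +
      1 / 3 * (levelGreen N x T (s + 1) (u + 1) v + levelGreen N x T (s + 1) (u + x) v) := by
  refine (levelGreen_le_succ T (s + 1) u v).trans (le_of_eq ?_)
  rw [levelGreen]

variable [NeZero N]

lemma sum_step_two_le_of_sum_consecutive_le {g F : ZMod N → ℝ} (hF0 : ∀ y, 0 ≤ F y)
    (hg : ∀ y, g y ≤ F y + 1 / 3 * (g (y + 1) + g (y + x))) {n : ℕ} {c : ℝ}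
    (hF : ∀ z, ∑ t ∈ range (2 * n), F (z + t) ≤ c) (z : ZMod N) :
    ∑ t ∈ range n, g (z + 2 * t) ≤ 2 * c := by
  set γ : ZMod N → ℝ := fun z => ∑ t ∈ range n, g (z + 2 * t) with hγ
  set φ : ZMod N → ℝ := fun z => ∑ t ∈ range n, F (z + 2 * t) with hφ
  have hφ0 : ∀ z, 0 ≤ φ z := fun z => sum_nonneg fun t _ => hF0 _
  have hφ1 : ∀ z, φ z + φ (z + 1) ≤ c := by
    intro z
    exact (sum_even_add_sum_odd F n z).le.trans (hF z)
  have hrec : ∀ z, γ z ≤ φ z + 1 / 3 * (γ (z + 1) + γ (z + x)) := by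
    intro z
    simp only [hγ, hφ]
    rw [← sum_add_distrib, mul_sum, ← sum_add_distrib]
    refine sum_le_sum fun t _ => (hg _).trans (le_of_eq ?_)
    rw [add_right_comm z 1, add_right_comm z x]
  have hb : ∀ z, γ z + γ (z + 1) ≤ 3 * c := by
    obtain ⟨m, -, hm⟩ := exists_max_image univ (fun z => γ z + γ (z + 1)) ⟨0, mem_univ _⟩
    have h1 := hm (m + 1) (mem_univ _)
    have h2 := hm (m + x) (mem_univ _)
    have h3 := hrec m
    have h4 := hrec (m + 1)
    have h5 := hφ1 m
    rw [add_right_comm m x 1] at h2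
    intro z
    have := hm z (mem_univ _)
    linarith
  obtain ⟨m, -, hm⟩ := exists_max_image univ γ ⟨0, mem_univ _⟩
  have ha : γ m ≤ 2 * c := by
    have e1 : ∀ z, z + 1 + x = z + x + 1 := fun z => add_right_comm _ _ _
    have k1 := hrec m
    have k2 := hrec (m + 1)
    have k3 := hrec (m + x)
    have k4 := hrec (m + x + 1)
    have k5 := hrec (m + x + x)
    have k6 := hrec (m + x + x + 1)
    have k7 := hb (m + x + x + x)
    simp only [e1] at k2 k4 k6
    have l1 := hm (m + 1 + 1) (mem_univ _)
    have l2 := hm (m + x + 1 + 1) (mem_univ _)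
    have l3 := hm (m + x + x + 1 + 1) (mem_univ _)
    have n1 := hφ1 m
    have n2 := hφ1 (m + x)
    have n3 := hφ1 (m + x + x)
    have p1 := hφ0 m
    have p2 := hφ0 (m + x)
    have p3 := hφ0 (m + x + x)
    have p4 := hφ0 (m + 1)
    have p5 := hφ0 (m + x + 1)
    have p6 := hφ0 (m + x + x + 1)
    linarith
  exact (hm z (mem_univ _)).trans ha

lemma sum_consecutive_le {g F : ZMod N → ℝ}
    (hg : ∀ y, g y ≤ F y + 1 / 3 * (g (y + 1) + g (y + x))) {n : ℕ} {c : ℝ}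
    (hF : ∀ z, ∑ t ∈ range n, F (z + t) ≤ c) (z : ZMod N) :
    ∑ t ∈ range n, g (z + t) ≤ 3 * c := by
  obtain ⟨m, -, hm⟩ :=
    exists_max_image univ (fun z => ∑ t ∈ range n, g (z + t)) ⟨0, mem_univ _⟩
  have h : ∑ t ∈ range n, g (m + t) ≤ ∑ t ∈ range n, F (m + t) +
      1 / 3 * (∑ t ∈ range n, g (m + 1 + t) + ∑ t ∈ range n, g (m + x + t)) := by
    rw [← sum_add_distrib, mul_sum, ← sum_add_distrib]
    refine sum_le_sum fun t _ => (hg _).trans (le_of_eq ?_)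
    rw [add_right_comm m 1, add_right_comm m x]
  have h1 := hm (m + 1) (mem_univ _)
  have h2 := hm (m + x) (mem_univ _)
  have h3 := hm z (mem_univ _)
  have h4 := hF m
  linarith

lemma sum_comp_two_mul (hN : Odd N) (f : ZMod N → ℝ) : ∑ y, f (2 * y) = ∑ y, f y := by
  obtain ⟨w, hw⟩ := isUnit_two_of_odd hN
  rw [← hw]
  exact Equiv.sum_comp (Units.mulLeft w) f

lemma sum_comp_add_right (f : ZMod N → ℝ) (c : ZMod N) : ∑ y, f (y + c) = ∑ y, f y :=
  Equiv.sum_comp (Equiv.addRight c) f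

lemma sum_step_two_le_sum (hN : Odd N) {n : ℕ} (hn : n ≤ N) {f : ZMod N → ℝ} (hf : ∀ y, 0 ≤ f y)
    (z : ZMod N) : ∑ t ∈ range n, f (z + 2 * t) ≤ ∑ y, f y := by
  have hinj : Set.InjOn (fun t : ℕ => z + 2 * (t : ZMod N)) (range n : Finset ℕ) := by
    intro a ha b hb h
    exact natCast_injOn_range hn ha hb ((isUnit_two_of_odd hN).mul_left_cancel (add_left_cancel h))
  rw [← sum_image (f := f) hinj]
  exact sum_le_sum_of_subset_of_nonneg (subset_univ _) fun y _ _ => hf y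

lemma block_chain_bound (hN : Odd N) {S : ℕ} (hS : 2 ^ S ≤ N)
    {k : ℕ → ZMod N → ℝ} {F : ZMod N → ℝ} (hk : ∀ s y, 0 ≤ k s y) (hF0 : ∀ y, 0 ≤ F y)
    (h0 : ∀ y, k 0 y ≤ F y + 1 / 3 * (k 0 (y + 1) + k 0 (y + x)))
    (hs : ∀ s y, k (s + 1) y ≤
      1 / 3 * k s (2 * y) + 1 / 3 * (k (s + 1) (y + 1) + k (s + 1) (y + x)))
    {B c : ℝ} (hc : 0 ≤ c) (hB : ∀ s, ∑ y, k s y ≤ B)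
    (hF : ∀ r < S, ∀ z, ∑ t ∈ range (2 ^ (r + 1)), F (z + t) ≤ c + B / 2 * (2 / 3) ^ (S - r))
    (s r : ℕ) (hr : r ≤ S) (z : ZMod N) :
    ∑ t ∈ range (2 ^ r), k s (z + 2 * t) ≤ 2 * c * (2 / 3) ^ s + B * (2 / 3) ^ (S - r) := by
  induction s generalizing r z with
  | zero =>
    rcases hr.lt_or_eq with h | rfl
    · have := sum_step_two_le_of_sum_consecutive_le hF0 h0 (n := 2 ^ r)
        (by simpa only [pow_succ'] using hF r h) z
      simp only [pow_zero]
      linarith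
    · have h1 := (sum_step_two_le_sum hN hS (hk 0) z).trans (hB 0)
      simp only [pow_zero, Nat.sub_self]
      linarith
  | succ s ih =>
    rcases hr.lt_or_eq with h | rfl
    · have h2 := sum_step_two_le_of_sum_consecutive_le (F := fun y => 1 / 3 * k s (2 * y))
        (fun y => by have := hk s (2 * y); positivity) (hs s) (n := 2 ^ r)
        (c := 1 / 3 * (2 * c * (2 / 3) ^ s + B * (2 / 3) ^ (S - (r + 1)))) (by
          intro z
          rw [← mul_sum, ← pow_succ']
          have := ih (r + 1) h (2 * z)
          simp only [mul_add]
          linarith) z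
      refine h2.trans (le_of_eq ?_)
      rw [show S - r = S - (r + 1) + 1 by omega, pow_succ, pow_succ]
      ring
    · have h1 := (sum_step_two_le_sum hN hS (hk (s + 1)) z).trans (hB (s + 1))
      have h2 : 0 ≤ 2 * c * (2 / 3 : ℝ) ^ (s + 1) := by positivity
      simp only [Nat.sub_self, pow_zero]
      linarith

lemma rhoMatrix_mulVec (x : ZMod N) (f : ZMod N → ℝ) (u : ZMod N) :
    ∑ w, rhoMatrix N x u w * f w = 1 / 3 * (f (u + 1) + f (u + x) + f (2 * u)) := by
  simp [rhoMatrix, mul_assoc, ← mul_sum, add_mul, sum_add_distrib]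

/-- The expected number of visits to `v` before time `T` of the walk started at `u`. -/
noncomputable def green (N : ℕ) [NeZero N] (x : ZMod N) (T : ℕ) (u v : ZMod N) : ℝ :=
  ∑ n ∈ range T, (rhoMatrix N x ^ n) u v

lemma sum_levelGreen_right_le (T s : ℕ) (u : ZMod N) : ∑ v, levelGreen N x T s u v ≤ 3 := by
  induction T generalizing s u with
  | zero => simp [levelGreen]
  | succ T ih =>
    cases s with
    | zero =>
      have h1 := ih 0 (u + 1)
      have h2 := ih 0 (u + x)
      simp only [levelGreen, sum_add_distrib, ← mul_sum, sum_ite_eq, mem_univ, if_true]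
      linarith
    | succ s =>
      have h1 := ih (s + 1) (u + 1)
      have h2 := ih (s + 1) (u + x)
      have h3 := ih s (2 * u)
      simp only [levelGreen, sum_add_distrib, ← mul_sum]
      linarith

lemma sum_levelGreen_left_le (hN : Odd N) (T s : ℕ) (v : ZMod N) :
    ∑ u, levelGreen N x T s u v ≤ 3 := by
  induction T generalizing s with
  | zero => simp [levelGreen]
  | succ T ih =>
    have e1 := fun s c => sum_comp_add_right (fun u => levelGreen N x T s u v) c
    have e2 := fun s => sum_comp_two_mul hN (fun u => levelGreen N x T s u v)
    cases s with
    | zero =>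
      have h1 := ih 0
      simp only [levelGreen, sum_add_distrib, ← mul_sum, sum_ite_eq', mem_univ, if_true, e1]
      linarith
    | succ s =>
      have h1 := ih (s + 1)
      have h3 := ih s
      simp only [levelGreen, sum_add_distrib, ← mul_sum, e1, e2]
      linarith

lemma sum_levelGreen_eq_green (T S : ℕ) (h : T ≤ S) (u v : ZMod N) :
    ∑ s ∈ range S, levelGreen N x T s u v = green N x T u v := by
  induction T generalizing S u with
  | zero => simp [levelGreen, green]
  | succ T ih =>
    obtain ⟨S, rfl⟩ : ∃ k, S = k + 1 := ⟨S - 1, by omega⟩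
    have hS : ∀ u, ∑ s ∈ range (S + 1), levelGreen N x T s u v = green N x T u v :=
      fun u => ih (S + 1) (by omega) u
    have hS1 := hS (u + 1)
    have hS2 := hS (u + x)
    rw [sum_range_succ'] at hS1 hS2
    rw [green, sum_range_succ', sum_range_succ']
    simp only [levelGreen, sum_add_distrib, ← mul_sum, pow_succ', Matrix.mul_apply, pow_zero,
      Matrix.one_apply]
    rw [sum_comm]
    simp only [← mul_sum]
    have := rhoMatrix_mulVec x (fun w => green N x T w v) u
    simp only [green] at this
    rw [this]
    simp only [green] at ih hS1 hS2
    rw [ih S (by omega) (2 * u), ← hS1, ← hS2]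
    ring

lemma levelGreen_sum_step_two_le (hN : Odd N) {S : ℕ} (hS : 2 ^ S ≤ N) (T s r : ℕ) (hr : r ≤ S)
    (z v : ZMod N) :
    ∑ t ∈ range (2 ^ r), levelGreen N x T s (z + 2 * t) v ≤
      2 * (2 / 3) ^ s + 3 * (2 / 3) ^ (S - r) := by
  have := block_chain_bound hN hS (x := x) (k := fun s u => levelGreen N x T s u v)
    (F := fun u => if u = v then 1 else 0) (fun s y => levelGreen_nonneg T s y v)
    (fun y => by split_ifs <;> simp) (fun y => levelGreen_zero_le T y v)
    (fun s y => levelGreen_succ_le T s y v) (c := 1) (B := 3) zero_le_one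
    (fun s => sum_levelGreen_left_le hN T s v) (fun r hr z => by
      refine (sum_consecutive_single_le ?_ v z).trans ?_
      · exact (Nat.pow_le_pow_right two_pos hr).trans hS
      · have : (0 : ℝ) ≤ 3 / 2 * (2 / 3) ^ (S - r) := by positivity
        linarith) s r hr z
  simpa using this

lemma levelGreen_le (hN : Odd N) {S : ℕ} (hS : 2 ^ S ≤ N) (T s : ℕ) (u v : ZMod N) :
    levelGreen N x T s u v ≤ 2 * (2 / 3) ^ s + 3 * (2 / 3) ^ S := by
  simpa using levelGreen_sum_step_two_le (x := x) hN hS T s 0 (Nat.zero_le _) u v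

lemma levelGreen_sum_consecutive_le (hN : Odd N) {S : ℕ} (hS : 2 ^ S ≤ N) (T s r : ℕ) (hr : r < S)
    (z v : ZMod N) :
    ∑ t ∈ range (2 ^ (r + 1)), levelGreen N x T s (z + t) v ≤
      3 * (2 / 3) ^ s + 9 / 2 * (2 / 3) ^ (S - r) := by
  cases s with
  | zero =>
    have h1 := sum_consecutive_le (x := x) (g := fun u => levelGreen N x T 0 u v)
      (F := fun u => if u = v then 1 else 0) (fun y => levelGreen_zero_le T y v)
      (fun z => sum_consecutive_single_le
        ((Nat.pow_le_pow_right two_pos (Nat.succ_le_of_lt hr)).trans hS) v z) z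
    have h2 : (0 : ℝ) ≤ 9 / 2 * (2 / 3) ^ (S - r) := by positivity
    simp only [Nat.succ_eq_add_one, mul_one, pow_zero] at h1 ⊢
    linarith
  | succ s =>
    have h1 := sum_consecutive_le (x := x) (g := fun u => levelGreen N x T (s + 1) u v)
      (F := fun u => 1 / 3 * levelGreen N x T s (2 * u) v)
      (fun y => levelGreen_succ_le T s y v) (n := 2 ^ (r + 1))
      (c := 1 / 3 * (2 * (2 / 3) ^ s + 3 * (2 / 3) ^ (S - (r + 1)))) (fun z => by
        rw [← mul_sum]
        have := levelGreen_sum_step_two_le (x := x) hN hS T s (r + 1) hr (2 * z) v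
        simp only [mul_add]
        linarith) z
    refine h1.trans (le_of_eq ?_)
    rw [show S - r = S - (r + 1) + 1 by omega, pow_succ, pow_succ]
    ring

lemma sum_levelGreen_mul_levelGreen_le (hN : Odd N) {S : ℕ} (hS : 2 ^ S ≤ N) (T s s' : ℕ)
    (u v : ZMod N) :
    ∑ w, levelGreen N x T s u w * levelGreen N x T s' w v ≤
      6 * ((2 / 3) ^ s * (2 / 3) ^ s') + 9 * (2 / 3) ^ S := by
  have hn := fun s u w => levelGreen_nonneg (x := x) T s u w
  have := block_chain_bound hN hS (x := x)
    (k := fun s u => ∑ w, levelGreen N x T s u w * levelGreen N x T s' w v)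
    (F := fun u => levelGreen N x T s' u v)
    (fun s y => sum_nonneg fun w _ => mul_nonneg (hn _ _ _) (hn _ _ _))
    (fun y => hn _ _ _) (fun y => by
      have : levelGreen N x T s' y v =
          ∑ w, (if y = w then 1 else 0) * levelGreen N x T s' w v := by simp
      rw [this, ← sum_add_distrib, mul_sum, ← sum_add_distrib]
      refine sum_le_sum fun w _ => ?_
      refine (mul_le_mul_of_nonneg_right (levelGreen_zero_le T y w) (hn s' w v)).trans
        (le_of_eq (by ring)))
    (fun s y => by
      rw [← sum_add_distrib, mul_sum, mul_sum, ← sum_add_distrib]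
      refine sum_le_sum fun w _ => ?_
      refine (mul_le_mul_of_nonneg_right (levelGreen_succ_le T s y w) (hn s' w v)).trans
        (le_of_eq (by ring)))
    (c := 3 * (2 / 3) ^ s') (B := 9) (by positivity)
    (fun s => by
      rw [sum_comm]
      calc ∑ w, ∑ y, levelGreen N x T s y w * levelGreen N x T s' w v
          ≤ ∑ w, 3 * levelGreen N x T s' w v := by
            refine sum_le_sum fun w _ => ?_
            rw [← sum_mul]
            exact mul_le_mul_of_nonneg_right (sum_levelGreen_left_le hN T s w) (hn s' w v)
        _ ≤ 9 := by
            rw [← mul_sum]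
            linarith [sum_levelGreen_left_le (x := x) hN T s' v])
    (fun r hr z => levelGreen_sum_consecutive_le hN hS T s' r hr z v) s 0 (Nat.zero_le _) u
  simp only [pow_zero, sum_range_one, Nat.cast_zero, mul_zero, add_zero, Nat.sub_zero] at this
  linarith

lemma sum_green_mul_green_eq (T : ℕ) (u : ZMod N) (e : ZMod N → ZMod N × ZMod N) :
    ∑ v, green N x T u v * green N x T (e v).1 (e v).2 = ∑ s ∈ range T, ∑ s' ∈ range T,
      ∑ v, levelGreen N x T s u v * levelGreen N x T s' (e v).1 (e v).2 := by
  simp only [← sum_levelGreen_eq_green T T le_rfl, sum_mul_sum]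
  rw [sum_comm]
  exact sum_congr rfl fun s _ => sum_comm

lemma sum_green_mul_green_swap_le (hN : Odd N) {S : ℕ} (hS : 2 ^ S ≤ N) (T : ℕ) (u : ZMod N) :
    ∑ v, green N x T u v * green N x T v u ≤ 54 + 9 * T ^ 2 * (2 / 3) ^ S := by
  rw [sum_green_mul_green_eq T u fun v => (v, u)]
  refine (sum_le_sum fun s _ => sum_le_sum fun s' _ =>
    sum_levelGreen_mul_levelGreen_le hN hS T s s' u u).trans ?_
  have hg : ∑ s ∈ range T, (2 / 3 : ℝ) ^ s ≤ 3 := by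
    rw [geom_sum_eq (by norm_num), div_le_iff_of_neg (by norm_num)]
    have : (0 : ℝ) ≤ (2 / 3) ^ T := by positivity
    linarith
  have hg0 : 0 ≤ ∑ s ∈ range T, (2 / 3 : ℝ) ^ s := sum_nonneg fun _ _ => by positivity
  simp only [sum_add_distrib, ← mul_sum, ← sum_mul, sum_const, card_range, nsmul_eq_mul]
  nlinarith

lemma sum_range_two_thirds_pow_max_le (T : ℕ) :
    ∑ s ∈ range T, ∑ s' ∈ range T, (2 / 3 : ℝ) ^ max s s' ≤ 15 := by
  have key : ∑ s ∈ range T, ∑ s' ∈ range T, (2 / 3 : ℝ) ^ max s s' =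
      15 - (2 / 3) ^ T * (6 * T + 15) := by
    induction T with
    | zero => simp
    | succ T ih =>
      have h : ∑ s ∈ range T, (2 / 3 : ℝ) ^ max s T = T * (2 / 3) ^ T := by
        rw [sum_congr rfl fun s hs => by rw [max_eq_right (mem_range.1 hs).le]]
        simp
      simp only [sum_range_succ, sum_add_distrib, ih, max_self, max_comm T, h, pow_succ]
      push_cast
      ring
  have : (0 : ℝ) ≤ (2 / 3) ^ T * (6 * T + 15) := by positivity
  linarith

lemma sum_green_sq_le (hN : Odd N) {S : ℕ} (hS : 2 ^ S ≤ N) (T : ℕ) (u : ZMod N) :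
    ∑ v, green N x T u v * green N x T u v ≤ 90 + 9 * T ^ 2 * (2 / 3) ^ S := by
  have hn := fun s u w => levelGreen_nonneg (x := x) T s u w
  have hmul : ∀ s s', ∑ v, levelGreen N x T s u v * levelGreen N x T s' u v ≤
      3 * (2 * (2 / 3) ^ s' + 3 * (2 / 3) ^ S) := fun s s' => by
    have h0 : (0 : ℝ) ≤ 2 * (2 / 3) ^ s' + 3 * (2 / 3) ^ S := by positivity
    calc ∑ v, levelGreen N x T s u v * levelGreen N x T s' u v
        ≤ ∑ v, levelGreen N x T s u v * (2 * (2 / 3) ^ s' + 3 * (2 / 3) ^ S) :=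
          sum_le_sum fun v _ =>
            mul_le_mul_of_nonneg_left (levelGreen_le hN hS T s' u v) (hn s u v)
      _ ≤ _ := by
          rw [← sum_mul]
          exact mul_le_mul_of_nonneg_right (sum_levelGreen_right_le T s u) h0
  rw [sum_green_mul_green_eq T u fun v => (u, v)]
  have : ∀ s s', ∑ v, levelGreen N x T s u v * levelGreen N x T s' u v ≤
      6 * (2 / 3) ^ max s s' + 9 * (2 / 3) ^ S := fun s s' => by
    rcases le_total s s' with h | h
    · rw [max_eq_right h]
      linarith [hmul s s']
    · rw [max_eq_left h, sum_congr rfl fun v _ => mul_comm _ _]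
      linarith [hmul s' s]
  refine (sum_le_sum fun s _ => sum_le_sum fun s' _ => this s s').trans ?_
  simp only [sum_add_distrib, ← mul_sum, sum_const, card_range, nsmul_eq_mul]
  nlinarith [sum_range_two_thirds_pow_max_le T]

end Local

/-! ### Mixing -/

section Mixing

variable {N : ℕ}

lemma rhoMatrix_nonneg (x u v : ZMod N) : 0 ≤ rhoMatrix N x u v := by
  unfold rhoMatrix
  positivity

variable [NeZero N] {x : ZMod N}

lemma rhoMatrix_pow_nonneg (n : ℕ) (u v : ZMod N) : 0 ≤ (rhoMatrix N x ^ n) u v := by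
  induction n generalizing u v with
  | zero => rw [pow_zero, Matrix.one_apply]; positivity
  | succ n ih =>
    rw [pow_succ, Matrix.mul_apply]
    exact sum_nonneg fun w _ => mul_nonneg (ih u w) (rhoMatrix_nonneg x w v)

lemma sum_rhoMatrix_pow_right (n : ℕ) (u : ZMod N) : ∑ v, (rhoMatrix N x ^ n) u v = 1 := by
  induction n generalizing u with
  | zero => simp [Matrix.one_apply]
  | succ n ih =>
    simp only [pow_succ', Matrix.mul_apply]
    rw [sum_comm]
    simp only [← mul_sum, ih]
    rw [rhoMatrix_mulVec x (fun _ => 1)]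
    norm_num

lemma sum_rhoMatrix_pow_left (hN : Odd N) (n : ℕ) (v : ZMod N) :
    ∑ u, (rhoMatrix N x ^ n) u v = 1 := by
  induction n with
  | zero => simp [Matrix.one_apply]
  | succ n ih =>
    simp only [pow_succ', Matrix.mul_apply, rhoMatrix_mulVec x (fun w => (rhoMatrix N x ^ n) w v)]
    rw [← mul_sum, sum_add_distrib, sum_add_distrib,
      sum_comp_add_right (fun w => (rhoMatrix N x ^ n) w v),
      sum_comp_add_right (fun w => (rhoMatrix N x ^ n) w v),
      sum_comp_two_mul hN (fun w => (rhoMatrix N x ^ n) w v), ih]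
    norm_num

/-- The expectation of the character `v ↦ χ (k * v)` after `n` steps from `u`. -/
noncomputable def rhoFourier (x : ZMod N) (n : ℕ) (k u : ZMod N) : ℂ :=
  ∑ v, ((rhoMatrix N x ^ n) u v : ℂ) * ZMod.stdAddChar (k * v)

lemma norm_stdAddChar (k : ZMod N) : ‖(ZMod.stdAddChar k : ℂ)‖ = 1 :=
  AddChar.norm_apply _ _

lemma rhoFourier_zero (k u : ZMod N) : rhoFourier x 0 k u = ZMod.stdAddChar (k * u) := by
  simp [rhoFourier, Matrix.one_apply, apply_ite Complex.ofReal]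

lemma rhoFourier_succ (n : ℕ) (k u : ZMod N) :
    rhoFourier x (n + 1) k u =
      1 / 3 * ((ZMod.stdAddChar k + ZMod.stdAddChar (k * x)) * rhoFourier x n k u +
        rhoFourier x n (2 * k) u) := by
  have h : ∀ w, ∑ v, (rhoMatrix N x w v : ℂ) * (ZMod.stdAddChar (k * v) : ℂ) =
      1 / 3 * ((ZMod.stdAddChar k + ZMod.stdAddChar (k * x)) * ZMod.stdAddChar (k * w) +
        ZMod.stdAddChar (2 * k * w)) := by
    intro w
    simp only [rhoMatrix, Complex.ofReal_mul, Complex.ofReal_add, apply_ite Complex.ofReal,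
      Complex.ofReal_one, Complex.ofReal_zero, mul_assoc, ← mul_sum, add_mul, sum_add_distrib,
      ite_mul, one_mul, zero_mul, sum_ite_eq', mem_univ, if_true, mul_add, AddChar.map_add_eq_mul]
    rw [mul_left_comm k 2 w, mul_one]
    push_cast
    ring
  simp only [rhoFourier, pow_succ, Matrix.mul_apply, Complex.ofReal_sum, Complex.ofReal_mul,
    sum_mul, mul_assoc]
  rw [sum_comm]
  simp only [← mul_sum, h]
  rw [mul_sum, ← sum_add_distrib, mul_sum]
  refine sum_congr rfl fun w _ => ?_
  rw [mul_assoc 2 k w]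
  ring

lemma norm_rhoFourier_add_two_le (n : ℕ) (k u : ZMod N) :
    ‖rhoFourier x (n + 2) k u‖ ≤ 4 / 9 * ‖rhoFourier x n k u‖ +
      (2 + ‖1 + (ZMod.stdAddChar k : ℂ)‖) / 9 * ‖rhoFourier x n (2 * k) u‖ +
      1 / 9 * ‖rhoFourier x n (2 * (2 * k)) u‖ := by
  have h2 : ∀ y : ZMod N, (ZMod.stdAddChar (2 * y) : ℂ) = ZMod.stdAddChar y ^ 2 := fun y => by
    rw [two_mul, AddChar.map_add_eq_mul, sq]
  rw [rhoFourier_succ, rhoFourier_succ, rhoFourier_succ, mul_assoc 2 k x, h2 k, h2 (k * x)]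
  set a := (ZMod.stdAddChar k : ℂ)
  set b := (ZMod.stdAddChar (k * x) : ℂ)
  have ha : ‖a‖ = 1 := norm_stdAddChar k
  have hb : ‖b‖ = 1 := norm_stdAddChar (k * x)
  have h1 : ‖(a + b) ^ 2‖ ≤ 4 := by
    rw [norm_pow]
    have := norm_add_le a b
    nlinarith [norm_nonneg (a + b)]
  have h3 : ‖a * (1 + a) + (b + b ^ 2)‖ ≤ 2 + ‖1 + a‖ := by
    have i1 := norm_add_le (a * (1 + a)) (b + b ^ 2)
    have i2 := norm_add_le b (b ^ 2)
    rw [norm_pow, hb] at i2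
    rw [norm_mul, ha] at i1
    linarith
  set A := rhoFourier x n k u
  set B := rhoFourier x n (2 * k) u
  set C := rhoFourier x n (2 * (2 * k)) u
  rw [show 1 / 3 * ((a + b) * (1 / 3 * ((a + b) * A + B)) + 1 / 3 * ((a ^ 2 + b ^ 2) * B + C)) =
    1 / 9 * ((a + b) ^ 2 * A + (a * (1 + a) + (b + b ^ 2)) * B + C) by ring, norm_mul]
  have i1 := norm_add₃_le (a := (a + b) ^ 2 * A) (b := (a * (1 + a) + (b + b ^ 2)) * B) (c := C)
  rw [norm_mul, norm_mul] at i1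
  have i2 := mul_le_mul_of_nonneg_right h1 (norm_nonneg A)
  have i3 := mul_le_mul_of_nonneg_right h3 (norm_nonneg B)
  have i4 : ‖(1 / 9 : ℂ)‖ = 1 / 9 := by norm_num
  rw [i4]
  linarith

lemma norm_pow_sub_one_le {z : ℂ} (hz : ‖z‖ = 1) (m : ℕ) : ‖z ^ m - 1‖ ≤ m * ‖z - 1‖ := by
  induction m with
  | zero => simp
  | succ m ih =>
    have h := norm_add_le (z * (z ^ m - 1)) (z - 1)
    rw [norm_mul, hz, show z * (z ^ m - 1) + (z - 1) = z ^ (m + 1) - 1 by ring] at h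
    push_cast
    linarith

lemma inv_le_norm_stdAddChar_sub_one {k : ZMod N} (hk : k ≠ 0) :
    1 / (N : ℝ) ≤ ‖(ZMod.stdAddChar k : ℂ) - 1‖ := by
  have hN : (0 : ℝ) < N := Nat.cast_pos.2 (NeZero.pos N)
  have hsum : ∑ t : ZMod N, (ZMod.stdAddChar (t * k) : ℂ) = 0 := by
    rw [AddChar.sum_mulShift k (ZMod.isPrimitive_stdAddChar N), if_neg hk, Nat.cast_zero]
  have h1 : ∀ t : ZMod N, ‖(ZMod.stdAddChar (t * k) : ℂ) - 1‖ ≤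
      N * ‖(ZMod.stdAddChar k : ℂ) - 1‖ := by
    intro t
    have : t * k = t.val • k := by rw [nsmul_eq_mul, ZMod.natCast_zmod_val]
    rw [this, AddChar.map_nsmul_eq_pow]
    refine (norm_pow_sub_one_le (norm_stdAddChar k) _).trans ?_
    gcongr
    exact (ZMod.val_lt t).le
  have h2 : (N : ℝ) ≤ N * (N * ‖(ZMod.stdAddChar k : ℂ) - 1‖) := by
    calc (N : ℝ) = ‖∑ t : ZMod N, ((ZMod.stdAddChar (t * k) : ℂ) - 1)‖ := by
          rw [sum_sub_distrib, hsum]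
          simp [ZMod.card]
      _ ≤ ∑ t : ZMod N, N * ‖(ZMod.stdAddChar k : ℂ) - 1‖ :=
          (norm_sum_le _ _).trans (sum_le_sum fun t _ => h1 t)
      _ = _ := by simp [ZMod.card]
  rw [div_le_iff₀ hN]
  nlinarith

/-- A potential for the multiplicative chain on nontrivial frequencies; it is larger for
frequencies closer to `0`. -/
noncomputable def freqPotential (k : ZMod N) : ℝ :=
  1 + 1 / 144 * (Real.log (2 / ‖(ZMod.stdAddChar k : ℂ) - 1‖) / Real.log (2 * N))

lemma one_le_freqPotential {k : ZMod N} (hk : k ≠ 0) : 1 ≤ freqPotential k := by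
  have hN : (1 : ℝ) ≤ N := Nat.one_le_cast.2 (NeZero.pos N)
  have hc := (one_div_pos.2 (zero_lt_one.trans_le hN)).trans_le (inv_le_norm_stdAddChar_sub_one hk)
  have hc2 : ‖(ZMod.stdAddChar k : ℂ) - 1‖ ≤ 2 := by
    have := norm_sub_le (ZMod.stdAddChar k : ℂ) 1
    rw [norm_stdAddChar, norm_one] at this
    linarith
  have h1 : 0 ≤ Real.log (2 / ‖(ZMod.stdAddChar k : ℂ) - 1‖) :=
    Real.log_nonneg ((one_le_div hc).2 hc2)
  have h2 : 0 ≤ Real.log (2 * N) := Real.log_nonneg (by linarith)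
  unfold freqPotential
  have := div_nonneg h1 h2
  linarith

lemma freqPotential_le {k : ZMod N} (hk : k ≠ 0) : freqPotential k ≤ 1 + 1 / 144 := by
  have hN : (1 : ℝ) ≤ N := Nat.one_le_cast.2 (NeZero.pos N)
  have hc := inv_le_norm_stdAddChar_sub_one hk
  have hc0 := (one_div_pos.2 (zero_lt_one.trans_le hN)).trans_le hc
  have h1 : Real.log (2 / ‖(ZMod.stdAddChar k : ℂ) - 1‖) ≤ Real.log (2 * N) := by
    refine Real.log_le_log (by positivity) ?_
    rw [div_le_iff₀ hc0]
    rw [div_le_iff₀ (zero_lt_one.trans_le hN)] at hc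
    linarith
  have := div_le_one_of_le₀ h1 (Real.log_nonneg (by linarith))
  unfold freqPotential
  linarith

lemma freqPotential_anti {k l : ZMod N} {r : ℝ} (hr : 0 < r) (hk : k ≠ 0)
    (h : r * ‖(ZMod.stdAddChar k : ℂ) - 1‖ ≤ ‖(ZMod.stdAddChar l : ℂ) - 1‖) :
    freqPotential l ≤ freqPotential k - 1 / 144 * (Real.log r / Real.log (2 * N)) := by
  have hN : (1 : ℝ) ≤ N := Nat.one_le_cast.2 (NeZero.pos N)
  have hk0 := (one_div_pos.2 (zero_lt_one.trans_le hN)).trans_le (inv_le_norm_stdAddChar_sub_one hk)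
  have hl0 := (mul_pos hr hk0).trans_le h
  have h1 : Real.log (2 / ‖(ZMod.stdAddChar l : ℂ) - 1‖) ≤
      Real.log (2 / ‖(ZMod.stdAddChar k : ℂ) - 1‖) - Real.log r := by
    rw [← Real.log_div (by positivity) hr.ne', div_div]
    refine Real.log_le_log (by positivity) ?_
    rw [mul_comm]
    gcongr
  have h2 : 0 ≤ Real.log (2 * N) := Real.log_nonneg (by linarith)
  have h3 := div_le_div_of_nonneg_right h1 h2
  rw [sub_div] at h3
  unfold freqPotential
  linarith

lemma freqPotential_contraction (hN : Odd N) (hN3 : 3 ≤ N) {k : ZMod N} (hk : k ≠ 0) :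
    4 / 9 * freqPotential k +
      (2 + ‖1 + (ZMod.stdAddChar k : ℂ)‖) / 9 * freqPotential (2 * k) +
      1 / 9 * freqPotential (2 * (2 * k)) ≤
    (1 - (1 / 144) ^ 2 / Real.log (2 * N)) * freqPotential k := by
  have hN' : (3 : ℝ) ≤ N := by exact_mod_cast hN3
  have hL : 1 ≤ Real.log (2 * N) := by
    rw [Real.le_log_iff_exp_le (by linarith)]
    linarith [Real.exp_one_lt_d9]
  have hd : ∀ y : ZMod N, y ≠ 0 → 2 * y ≠ 0 := fun y hy h =>
    hy ((isUnit_two_of_odd hN).mul_right_eq_zero.1 h)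
  have hk2 := hd k hk
  have hk4 := hd _ hk2
  have w1 := one_le_freqPotential hk
  have w1' := freqPotential_le hk
  have w2 := one_le_freqPotential hk2
  have w2' := freqPotential_le hk2
  have w4' := freqPotential_le hk4
  have hi : 0 < (Real.log (2 * N))⁻¹ := by positivity
  have hi1 : (Real.log (2 * N))⁻¹ ≤ 1 := inv_le_one_of_one_le₀ hL
  have hdbl : ∀ y : ZMod N, ‖(ZMod.stdAddChar (2 * y) : ℂ) - 1‖ =
      ‖(ZMod.stdAddChar y : ℂ) - 1‖ * ‖1 + (ZMod.stdAddChar y : ℂ)‖ := fun y => by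
    rw [two_mul, AddChar.map_add_eq_mul, ← norm_mul]
    congr 1
    ring
  have hge : ∀ y : ZMod N, 2 - ‖(ZMod.stdAddChar y : ℂ) - 1‖ ≤ ‖1 + (ZMod.stdAddChar y : ℂ)‖ :=
      fun y => by
    have := norm_sub_le (1 + (ZMod.stdAddChar y : ℂ)) ((ZMod.stdAddChar y : ℂ) - 1)
    rw [show (1 + (ZMod.stdAddChar y : ℂ)) - ((ZMod.stdAddChar y : ℂ) - 1) = 2 by ring] at this
    rw [Complex.norm_ofNat] at this
    linarith
  have hpar : ‖1 + (ZMod.stdAddChar k : ℂ)‖ ^ 2 + ‖(ZMod.stdAddChar k : ℂ) - 1‖ ^ 2 = 4 := by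
    have h1 := norm_stdAddChar k
    have h2 : Complex.normSq (ZMod.stdAddChar k : ℂ) = 1 := by
      rw [Complex.normSq_eq_norm_sq, h1, one_pow]
    rw [← Complex.normSq_eq_norm_sq, ← Complex.normSq_eq_norm_sq]
    rw [Complex.normSq_apply] at h2 ⊢
    rw [Complex.normSq_apply]
    simp
    linarith
  set c := ‖(ZMod.stdAddChar k : ℂ) - 1‖ with hc
  set s := ‖1 + (ZMod.stdAddChar k : ℂ)‖ with hs
  have hs0 : 0 ≤ s := norm_nonneg _
  have hc0 : 0 ≤ c := norm_nonneg _
  rw [div_eq_mul_inv _ (Real.log (2 * N))]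
  rcases le_or_gt (1 / 2) c with hgood | hbad
  · have hs2 : s ≤ 2 - 1 / 16 := by nlinarith
    nlinarith
  · have hs2 : s ≤ 2 := by nlinarith
    have hk2c : 3 / 2 * c ≤ ‖(ZMod.stdAddChar (2 * k) : ℂ) - 1‖ := by
      rw [hdbl k]
      have := hge k
      nlinarith
    have hk2c' : ‖(ZMod.stdAddChar (2 * k) : ℂ) - 1‖ ≤ 1 := by
      rw [hdbl k]
      nlinarith
    have hk4c : 1 * c ≤ ‖(ZMod.stdAddChar (2 * (2 * k)) : ℂ) - 1‖ := by
      rw [hdbl (2 * k)]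
      have := hge (2 * k)
      nlinarith
    have p2 := freqPotential_anti (by norm_num) hk hk2c
    have p4 := freqPotential_anti one_pos hk hk4c
    have hlog : 1 / 3 ≤ Real.log (3 / 2) := by
      have := Real.one_sub_inv_le_log_of_pos (show (0 : ℝ) < 3 / 2 by norm_num)
      norm_num at this ⊢
      linarith
    rw [div_eq_mul_inv (Real.log (3 / 2))] at p2
    rw [Real.log_one, zero_div] at p4
    have p2' := mul_le_mul_of_nonneg_right hlog hi.le
    have p5 : (2 + s) / 9 * freqPotential (2 * k) ≤ 4 / 9 * freqPotential (2 * k) := by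
      gcongr
      linarith
    have p6 := mul_le_mul_of_nonneg_left w1' hi.le
    linarith

lemma norm_rhoFourier_le (hN : Odd N) (hN3 : 3 ≤ N) (n : ℕ) {k : ZMod N} (hk : k ≠ 0)
    (u : ZMod N) :
    ‖rhoFourier x (2 * n) k u‖ ≤
      (1 - (1 / 144) ^ 2 / Real.log (2 * N)) ^ n * freqPotential k := by
  have hN' : (3 : ℝ) ≤ N := by exact_mod_cast hN3
  have hL : 1 ≤ Real.log (2 * N) := by
    rw [Real.le_log_iff_exp_le (by linarith)]
    linarith [Real.exp_one_lt_d9]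
  have hρ : 0 ≤ 1 - (1 / 144 : ℝ) ^ 2 / Real.log (2 * N) := by
    have := div_le_self (show (0 : ℝ) ≤ (1 / 144) ^ 2 by positivity) hL
    linarith
  induction n generalizing k with
  | zero =>
    rw [mul_zero, rhoFourier_zero, norm_stdAddChar, pow_zero, one_mul]
    exact one_le_freqPotential hk
  | succ n ih =>
    have hd : ∀ y : ZMod N, y ≠ 0 → 2 * y ≠ 0 := fun y hy h =>
      hy ((isUnit_two_of_odd hN).mul_right_eq_zero.1 h)
    have h1 := ih hk
    have h2 := ih (hd k hk)
    have h4 := ih (hd _ (hd k hk))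
    set ρ := 1 - (1 / 144 : ℝ) ^ 2 / Real.log (2 * N)
    calc ‖rhoFourier x (2 * (n + 1)) k u‖ ≤ _ := norm_rhoFourier_add_two_le (2 * n) k u
      _ ≤ 4 / 9 * (ρ ^ n * freqPotential k) +
          (2 + ‖1 + (ZMod.stdAddChar k : ℂ)‖) / 9 * (ρ ^ n * freqPotential (2 * k)) +
          1 / 9 * (ρ ^ n * freqPotential (2 * (2 * k))) := by gcongr
      _ = ρ ^ n * (4 / 9 * freqPotential k +
          (2 + ‖1 + (ZMod.stdAddChar k : ℂ)‖) / 9 * freqPotential (2 * k) +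
          1 / 9 * freqPotential (2 * (2 * k))) := by ring
      _ ≤ ρ ^ n * (ρ * freqPotential k) :=
          mul_le_mul_of_nonneg_left (freqPotential_contraction hN hN3 hk) (pow_nonneg hρ n)
      _ = _ := by rw [pow_succ, mul_assoc]

lemma rhoMatrix_pow_eq_sum_rhoFourier (n : ℕ) (u v : ZMod N) :
    ((rhoMatrix N x ^ n) u v : ℂ) =
      1 / N * ∑ k, rhoFourier x n k u * ZMod.stdAddChar (k * -v) := by
  have hN : (N : ℂ) ≠ 0 := Nat.cast_ne_zero.2 (NeZero.ne N)
  simp only [rhoFourier, sum_mul, mul_assoc]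
  rw [sum_comm]
  simp only [← mul_sum, ← AddChar.map_add_eq_mul, ← mul_add,
    AddChar.sum_mulShift _ (ZMod.isPrimitive_stdAddChar N), ZMod.card]
  rw [Fintype.sum_eq_single v fun w hw => by
    rw [if_neg fun h => hw (add_neg_eq_zero.1 h)]; simp]
  simp
  field_simp

lemma abs_rhoMatrix_pow_sub_le (hN : Odd N) (hN3 : 3 ≤ N) (n : ℕ) (u v : ZMod N) :
    |(rhoMatrix N x ^ (2 * n)) u v - 1 / N| ≤
      2 * (1 - (1 / 144) ^ 2 / Real.log (2 * N)) ^ n := by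
  have hN0 : (0 : ℝ) < N := Nat.cast_pos.2 (NeZero.pos N)
  have hN' : (3 : ℝ) ≤ N := by exact_mod_cast hN3
  have hL : 1 ≤ Real.log (2 * N) := by
    rw [Real.le_log_iff_exp_le (by linarith)]
    linarith [Real.exp_one_lt_d9]
  have hρ : 0 ≤ (1 - (1 / 144 : ℝ) ^ 2 / Real.log (2 * N)) ^ n := by
    have := div_le_self (show (0 : ℝ) ≤ (1 / 144) ^ 2 by positivity) hL
    exact pow_nonneg (by linarith) n
  have h0 : rhoFourier x (2 * n) 0 u = 1 := by
    simp only [rhoFourier, zero_mul, AddChar.map_zero_eq_one, mul_one]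
    rw [← Complex.ofReal_sum, sum_rhoMatrix_pow_right, Complex.ofReal_one]
  have h1 : (((rhoMatrix N x ^ (2 * n)) u v - 1 / N : ℝ) : ℂ) =
      1 / N * ∑ k ∈ univ.erase 0, rhoFourier x (2 * n) k u * ZMod.stdAddChar (k * -v) := by
    push_cast
    rw [rhoMatrix_pow_eq_sum_rhoFourier, ← add_sum_erase _ _ (mem_univ 0), h0]
    simp only [zero_mul, AddChar.map_zero_eq_one]
    ring
  rw [← Real.norm_eq_abs, ← Complex.norm_real, h1, norm_mul]
  set ρ := (1 - (1 / 144 : ℝ) ^ 2 / Real.log (2 * N)) ^ n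
  have h2 : ‖∑ k ∈ univ.erase 0, rhoFourier x (2 * n) k u * ZMod.stdAddChar (k * -v)‖ ≤
      N * (2 * ρ) := by
    calc _ ≤ ∑ k ∈ univ.erase (0 : ZMod N), 2 * ρ := by
          refine (norm_sum_le _ _).trans (sum_le_sum fun k hk => ?_)
          have hk := ne_of_mem_erase hk
          rw [norm_mul, norm_stdAddChar, mul_one]
          refine (norm_rhoFourier_le hN hN3 n hk u).trans ?_
          rw [mul_comm 2 ρ]
          exact mul_le_mul_of_nonneg_left 
            ((freqPotential_le hk).trans (by norm_num : (1 : ℝ) + 1 / 144 ≤ 2)) hρ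
      _ ≤ ∑ k : ZMod N, 2 * ρ :=
          sum_le_sum_of_subset_of_nonneg (subset_univ _) fun _ _ _ => by positivity
      _ = _ := by simp [ZMod.card]
  have h3 : ‖(1 / N : ℂ)‖ = 1 / N := by simp
  rw [h3, one_div_mul_eq_div, div_le_iff₀ hN0]
  linarith

lemma abs_rhoMatrix_pow_sub_le_of_le {c : ℝ} {T t : ℕ} (hTt : T ≤ t)
    (h : ∀ u v, |(rhoMatrix N x ^ T) u v - 1 / N| ≤ c) (u v : ZMod N) :
    |(rhoMatrix N x ^ t) u v - 1 / N| ≤ c := by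
  obtain ⟨k, rfl⟩ := Nat.exists_eq_add_of_le' hTt
  have h1 : (rhoMatrix N x ^ (k + T)) u v - 1 / N =
      ∑ w, (rhoMatrix N x ^ k) u w * ((rhoMatrix N x ^ T) w v - 1 / N) := by
    simp only [pow_add, Matrix.mul_apply, mul_sub, sum_sub_distrib, ← sum_mul,
      sum_rhoMatrix_pow_right, one_mul]
  rw [h1]
  calc _ ≤ ∑ w, (rhoMatrix N x ^ k) u w * c := by
        refine (abs_sum_le_sum_abs _ _).trans (sum_le_sum fun w _ => ?_)
        rw [abs_mul, abs_of_nonneg (rhoMatrix_pow_nonneg k u w)]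
        exact mul_le_mul_of_nonneg_left (h w v) (rhoMatrix_pow_nonneg k u w)
    _ = c := by rw [← sum_mul, sum_rhoMatrix_pow_right, one_mul]

end Mixing

/-! ### Multi-time laws of a Markov trajectory -/

section Markov

lemma dependsOn_eval_and {S : Type*} {n m : ℕ} {Q : (ℕ → S) → Prop} (hQ : DependsOn Q (Set.Iic n))
    (hm : m ≤ n) (a : S) : DependsOn (fun z => Q z ∧ z m = a) (Set.Iic n) := fun y z hyz => by
  simp only [hQ hyz, hyz m hm]

variable {S Ω : Type*} [MeasurableSpace Ω] [MeasurableSpace S] [MeasurableSingletonClass S]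
  [Fintype S] {μ : Measure Ω} [IsFiniteMeasure μ] {P : Matrix S S ℝ} {X : ℕ → Ω → S}

lemma measureReal_eq_sum_fiber {f : Ω → S} (hf : Measurable f) (p : Ω → Prop) :
    μ.real {ω | p ω} = ∑ c, μ.real {ω | p ω ∧ f ω = c} := by
  have h := sum_measureReal_preimage_singleton (μ := μ.restrict {ω | p ω}) (univ : Finset S)
    (f := f) fun y _ => hf (measurableSet_singleton y)
  rw [coe_univ, Set.preimage_univ, measureReal_restrict_apply .univ, Set.univ_inter] at h
  rw [← h]
  refine sum_congr rfl fun c _ => ?_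
  rw [measureReal_restrict_apply (hf (measurableSet_singleton c)), Set.inter_comm]
  rfl

lemma IsMarkovTraj.step (h : IsMarkovTraj μ P X) (hX : ∀ n, Measurable (X n)) {n : ℕ}
    {Q : (ℕ → S) → Prop} (hQ : DependsOn Q (Set.Iic n)) (a b : S) :
    μ.real {ω | (Q (fun i => X i ω) ∧ X n ω = a) ∧ X (n + 1) ω = b} =
      P a b * μ.real {ω | Q (fun i => X i ω) ∧ X n ω = a} := by
  have hZ : Measurable fun ω => fun i : Fin (n + 1) => X i ω := measurable_pi_lambda _ fun i => hX i
  rw [measureReal_eq_sum_fiber hZ, measureReal_eq_sum_fiber hZ, mul_sum]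
  refine sum_congr rfl fun z _ => ?_
  set y : ℕ → S := fun i => if hi : i < n + 1 then z ⟨i, hi⟩ else b with hy
  have hyn : y (n + 1) = b := by simp [hy]
  have hcyl : ∀ ω, (fun i : Fin (n + 1) => X i ω) = z ↔ ∀ i ≤ n, X i ω = y i := by
    intro ω
    rw [funext_iff]
    refine ⟨fun H i hi => ?_, fun H i => ?_⟩
    · simpa [hy, hi] using H ⟨i, Nat.lt_succ_of_le hi⟩
    · simpa [hy, Nat.le_of_lt_succ i.2] using H i (Nat.le_of_lt_succ i.2)
  have hQy : ∀ ω, (∀ i ≤ n, X i ω = y i) → Q (fun i => X i ω) = Q y := fun ω H => hQ H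
  simp only [hcyl]
  by_cases hc : Q y ∧ y n = a
  · have e1 : {ω | ((Q (fun i => X i ω) ∧ X n ω = a) ∧ X (n + 1) ω = b) ∧ ∀ i ≤ n, X i ω = y i} =
        {ω | ∀ i ≤ n + 1, X i ω = y i} := by
      ext ω
      refine ⟨fun H i hi => ?_, fun H => ?_⟩
      · rcases Nat.le_succ_iff.1 hi with hi | rfl
        · exact H.2 i hi
        · rw [hyn]; exact H.1.2
      · have H' : ∀ i ≤ n, X i ω = y i := fun i hi => H i (hi.trans n.le_succ)
        refine ⟨⟨⟨?_, ?_⟩, ?_⟩, H'⟩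
        · rw [hQy ω H']; exact hc.1
        · rw [H' n le_rfl, hc.2]
        · rw [H _ le_rfl, hyn]
    have e2 : {ω | (Q (fun i => X i ω) ∧ X n ω = a) ∧ ∀ i ≤ n, X i ω = y i} =
        {ω | ∀ i ≤ n, X i ω = y i} := by
      ext ω
      refine ⟨fun H => H.2, fun H => ⟨⟨?_, ?_⟩, H⟩⟩
      · rw [hQy ω H]; exact hc.1
      · rw [H n le_rfl, hc.2]
    rw [e1, e2, ← hc.2, ← hyn]
    exact h n y
  · have e : ∀ ω, ¬ ((Q (fun i => X i ω) ∧ X n ω = a) ∧ ∀ i ≤ n, X i ω = y i) := by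
      rintro ω ⟨⟨H1, H2⟩, H⟩
      exact hc ⟨hQy ω H ▸ H1, by rw [← H n le_rfl, H2]⟩
    have e1 : {ω | ((Q (fun i => X i ω) ∧ X n ω = a) ∧ X (n + 1) ω = b) ∧
        ∀ i ≤ n, X i ω = y i} = ∅ :=
      Set.eq_empty_of_forall_notMem fun ω H => e ω ⟨H.1.1, H.2⟩
    have e2 : {ω | (Q (fun i => X i ω) ∧ X n ω = a) ∧ ∀ i ≤ n, X i ω = y i} = ∅ :=
      Set.eq_empty_of_forall_notMem e
    rw [e1, e2, measureReal_empty, mul_zero]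

lemma IsMarkovTraj.steps [DecidableEq S] (h : IsMarkovTraj μ P X) (hX : ∀ n, Measurable (X n))
    {n : ℕ} {Q : (ℕ → S) → Prop} (hQ : DependsOn Q (Set.Iic n)) (a b : S) (k : ℕ) :
    μ.real {ω | (Q (fun i => X i ω) ∧ X n ω = a) ∧ X (n + k) ω = b} =
      μ.real {ω | Q (fun i => X i ω) ∧ X n ω = a} * (P ^ k) a b := by
  induction k generalizing b with
  | zero =>
    rw [pow_zero, Matrix.one_apply, add_zero]
    split_ifs with hab
    · rw [mul_one]
      congr 1
      ext ω
      simp +contextual [hab]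
    · rw [mul_zero, ← measureReal_empty (μ := μ)]
      congr 1
      exact Set.eq_empty_of_forall_notMem fun ω H => hab (H.1.2.symm.trans H.2)
  | succ k ih =>
    rw [measureReal_eq_sum_fiber (hX (n + k)), pow_succ, Matrix.mul_apply, mul_sum]
    refine sum_congr rfl fun c _ => ?_
    have hQ' : DependsOn (fun z => Q z ∧ z n = a) (Set.Iic (n + k)) :=
      (dependsOn_eval_and hQ le_rfl a).mono (Set.Iic_subset_Iic.2 (Nat.le_add_right n k))
    have := h.step hX hQ' c b
    rw [ih c] at this
    rw [← mul_assoc, mul_comm _ (P c b), ← this]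
    congr 1
    ext ω
    simp only [Set.mem_ofPred_eq, add_assoc]
    tauto

lemma IsMarkovTraj.two_times [DecidableEq S] (h : IsMarkovTraj μ P X)
    (hX : ∀ n, Measurable (X n)) (a b : S) (i k : ℕ) :
    μ.real {ω | X i ω = a ∧ X (i + k) ω = b} = μ.real {ω | X i ω = a} * (P ^ k) a b := by
  have := h.steps hX (n := i) (Q := fun _ => True) (fun _ _ _ => rfl) a b k
  simpa only [true_and] using this

lemma IsMarkovTraj.four_times [DecidableEq S] (h : IsMarkovTraj μ P X)
    (hX : ∀ n, Measurable (X n)) (a b c d : S) (i k l m : ℕ) :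
    μ.real {ω | ((X i ω = a ∧ X (i + k) ω = b) ∧ X (i + k + l) ω = c) ∧
      X (i + k + l + m) ω = d} =
      μ.real {ω | X i ω = a} * ((P ^ k) a b * (P ^ l) b c * (P ^ m) c d) := by
  have d1 : DependsOn (fun z : ℕ → S => z i = a) (Set.Iic (i + k)) := fun y z hyz => by
    simp only [hyz i (Nat.le_add_right i k)]
  have d2 := (dependsOn_eval_and d1 le_rfl b).mono
    (Set.Iic_subset_Iic.2 (Nat.le_add_right (i + k) l))
  rw [h.steps hX d2 c d m, h.steps hX d1 b c l, h.two_times hX]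
  ring

/-- Conditioning on an event determined by the first `n + 1` coordinates and shifting by `n` yields
a Markov trajectory. -/
lemma IsMarkovTraj.restrict_shift (h : IsMarkovTraj μ P X) (hX : ∀ n, Measurable (X n)) {n : ℕ}
    {Q : (ℕ → S) → Prop} (hQ : DependsOn Q (Set.Iic n)) :
    IsMarkovTraj (μ.restrict {ω | Q fun i => X i ω}) P fun i => X (n + i) := by
  intro m y
  have hmeas : ∀ k, MeasurableSet {ω | ∀ i ≤ k, X (n + i) ω = y i} := fun k => by
    simp only [Set.ofPred_forall]
    exact .iInter fun i => .iInter fun _ => hX _ (measurableSet_singleton _)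
  have hQ' : DependsOn (fun z => Q z ∧ ∀ i ≤ m, z (n + i) = y i) (Set.Iic (n + m)) := by
    intro z w hzw
    have h1 : Q z = Q w := hQ fun i hi => hzw i (le_trans hi (Nat.le_add_right n m))
    have h2 : ∀ i ≤ m, z (n + i) = w (n + i) := fun i hi => hzw _ (Nat.add_le_add_left hi n)
    simp only [h1]
    refine propext (and_congr_right fun _ => forall₂_congr fun i hi => ?_)
    rw [h2 i hi]
  have := h.step hX hQ' (y m) (y (m + 1))
  rw [Measure.restrict_apply (hmeas _), Measure.restrict_apply (hmeas _)]
  simp only [Measure.real] at this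
  convert this using 3
  · ext ω
    simp only [Set.mem_inter_iff, Set.mem_ofPred_eq, add_assoc]
    refine ⟨fun H => ⟨⟨⟨H.2, fun i hi => H.1 i (hi.trans m.le_succ)⟩, H.1 m m.le_succ⟩,
      H.1 _ le_rfl⟩, fun H => ⟨fun i hi => ?_, H.1.1.1⟩⟩
    rcases Nat.le_succ_iff.1 hi with hi | rfl
    · exact H.1.1.2 i hi
    · exact H.2
  · congr 1
    ext ω
    simp only [Set.mem_inter_iff, Set.mem_ofPred_eq]
    exact ⟨fun H => ⟨⟨H.2, H.1⟩, H.1 m le_rfl⟩, fun H => ⟨H.1.2, H.1.1⟩⟩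

end Markov

/-! ### Second moment bound for the number of collisions -/

section SecondMoment

lemma measureReal_forall_notMem_le {Ω ι : Type*} [MeasurableSpace Ω] {μ : Measure Ω}
    [IsFiniteMeasure μ] (I : Finset ι) {E : ι → Set Ω} (hE : ∀ p, MeasurableSet (E p)) (θ : ℝ) :
    μ.real {ω | ∀ p ∈ I, ω ∉ E p} ≤ μ.real Set.univ - 2 * θ * ∑ p ∈ I, μ.real (E p) +
      θ ^ 2 * ∑ p ∈ I, ∑ q ∈ I, μ.real (E p ∩ E q) := by
  have hint : ∀ s : Set Ω, MeasurableSet s → Integrable (s.indicator (1 : Ω → ℝ)) μ := fun s hs =>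
    (integrable_const (1 : ℝ)).indicator hs
  have hA : MeasurableSet {ω | ∀ p ∈ I, ω ∉ E p} := by
    simp only [Set.ofPred_forall]
    exact I.measurableSet_biInter fun p _ => (hE p).compl
  have h1 : Integrable (fun ω => ∑ p ∈ I, (E p).indicator (1 : Ω → ℝ) ω) μ :=
    integrable_finsetSum _ fun p _ => hint _ (hE p)
  have h2 : Integrable (fun ω => ∑ p ∈ I, ∑ q ∈ I, (E p ∩ E q).indicator (1 : Ω → ℝ) ω) μ :=
    integrable_finsetSum _ fun p _ => integrable_finsetSum _ fun q _ =>
      hint _ ((hE p).inter (hE q))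
  have h5 : Integrable (fun ω => 1 - 2 * θ * ∑ p ∈ I, (E p).indicator (1 : Ω → ℝ) ω) μ :=
    (integrable_const _).sub (h1.const_mul _)
  have h3 : μ.real Set.univ - 2 * θ * ∑ p ∈ I, μ.real (E p) +
      θ ^ 2 * ∑ p ∈ I, ∑ q ∈ I, μ.real (E p ∩ E q) =
      ∫ ω, (1 - 2 * θ * ∑ p ∈ I, (E p).indicator (1 : Ω → ℝ) ω +
        θ ^ 2 * ∑ p ∈ I, ∑ q ∈ I, (E p ∩ E q).indicator (1 : Ω → ℝ) ω) ∂μ := by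
    rw [integral_add h5 (h2.const_mul _),
      integral_sub (integrable_const _) (h1.const_mul _), integral_const_mul, integral_const_mul,
      integral_finsetSum _ fun p _ => hint _ (hE p),
      integral_finsetSum _ fun p _ => integrable_finsetSum _ fun q _ =>
        hint _ ((hE p).inter (hE q)), integral_const, smul_eq_mul, mul_one]
    congr 2
    · congr 1
      exact sum_congr rfl fun p _ => (integral_indicator_one (hE p)).symm
    · refine sum_congr rfl fun p _ => ?_
      rw [integral_finsetSum _ fun q _ => hint _ ((hE p).inter (hE q))]
      exact sum_congr rfl fun q _ => (integral_indicator_one ((hE p).inter (hE q))).symm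
  rw [h3, ← integral_indicator_one hA]
  refine integral_mono (hint _ hA)
    (h5.add (h2.const_mul _)) fun ω => ?_
  have h4 : ∑ p ∈ I, ∑ q ∈ I, (E p ∩ E q).indicator (1 : Ω → ℝ) ω =
      (∑ p ∈ I, (E p).indicator (1 : Ω → ℝ) ω) ^ 2 := by
    rw [sq, sum_mul_sum]
    simp only [Set.inter_indicator_one, Pi.mul_apply]
  simp only [h4]
  by_cases hω : ω ∈ {ω | ∀ p ∈ I, ω ∉ E p}
  · rw [Set.indicator_of_mem hω, sum_eq_zero fun p hp => Set.indicator_of_notMem (hω p hp) _]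
    simp
  · rw [Set.indicator_of_notMem hω]
    nlinarith [sq_nonneg (1 - θ * ∑ p ∈ I, (E p).indicator (1 : Ω → ℝ) ω)]

variable {N : ℕ} [NeZero N] {x : ZMod N} {Ω : Type*} [MeasurableSpace Ω] {μ : Measure Ω}
  {X : ℕ → Ω → ZMod N} {T : ℕ} {m : ℝ}

/-- The contribution of time gaps `d`, `e` shorter than the mixing time to the probability of
two simultaneous collisions with interleaved time intervals. -/
noncomputable def overlapWeight (μ : Measure Ω) (x : ZMod N) (X : ℕ → Ω → ZMod N) (m : ℝ)
    (i d e : ℕ) : ℝ :=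
  m * ∑ a, μ.real {ω | X i ω = a} * ∑ c, (rhoMatrix N x ^ d) a c * (rhoMatrix N x ^ e) a c

/-- The analogue of `overlapWeight` for nested time intervals. -/
noncomputable def nestedWeight (μ : Measure Ω) (x : ZMod N) (X : ℕ → Ω → ZMod N) (m : ℝ)
    (i d e : ℕ) : ℝ :=
  m * ∑ a, μ.real {ω | X i ω = a} * ∑ c, (rhoMatrix N x ^ d) a c * (rhoMatrix N x ^ e) c a

/-- The correlation of the collisions at the pairs of times `p` and `q`, where `p.1 ≤ q.1`. -/
noncomputable def correlation (μ : Measure Ω) (x : ZMod N) (X : ℕ → Ω → ZMod N) (m : ℝ) (T : ℕ)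
    (p q : ℕ × ℕ) : ℝ :=
  ∑ d ∈ range T, ∑ e ∈ range T,
    ((if q = (p.1 + d, p.2 + e) then overlapWeight μ x X m p.1 d e else 0) +
      if q = (p.1 + d, p.2 - e) then nestedWeight μ x X m p.1 d e else 0)

lemma overlapWeight_nonneg (hm : 0 ≤ m) (i d e : ℕ) : 0 ≤ overlapWeight μ x X m i d e :=
  mul_nonneg hm <| sum_nonneg fun _ _ => mul_nonneg measureReal_nonneg <|
    sum_nonneg fun _ _ => mul_nonneg (rhoMatrix_pow_nonneg _ _ _) (rhoMatrix_pow_nonneg _ _ _)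

lemma nestedWeight_nonneg (hm : 0 ≤ m) (i d e : ℕ) : 0 ≤ nestedWeight μ x X m i d e :=
  mul_nonneg hm <| sum_nonneg fun _ _ => mul_nonneg measureReal_nonneg <|
    sum_nonneg fun _ _ => mul_nonneg (rhoMatrix_pow_nonneg _ _ _) (rhoMatrix_pow_nonneg _ _ _)

lemma correlation_summand_nonneg (hm : 0 ≤ m) (p q : ℕ × ℕ) (d e : ℕ) :
    0 ≤ ((if q = (p.1 + d, p.2 + e) then overlapWeight μ x X m p.1 d e else 0) +
      if q = (p.1 + d, p.2 - e) then nestedWeight μ x X m p.1 d e else 0) := by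
  have h1 := overlapWeight_nonneg (μ := μ) (x := x) (X := X) hm p.1 d e
  have h2 := nestedWeight_nonneg (μ := μ) (x := x) (X := X) hm p.1 d e
  positivity

lemma correlation_nonneg (hm : 0 ≤ m) (p q : ℕ × ℕ) : 0 ≤ correlation μ x X m T p q :=
  sum_nonneg fun d _ => sum_nonneg fun e _ => correlation_summand_nonneg hm p q d e

lemma summand_le_correlation (hm : 0 ≤ m) (p q : ℕ × ℕ) {d e : ℕ} (hd : d < T) (he : e < T) :
    ((if q = (p.1 + d, p.2 + e) then overlapWeight μ x X m p.1 d e else 0) +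
      if q = (p.1 + d, p.2 - e) then nestedWeight μ x X m p.1 d e else 0) ≤
    correlation μ x X m T p q :=
  (single_le_sum (f := fun _ => _ + _) (fun e _ => correlation_summand_nonneg hm p q d e)
    (mem_range.2 he)).trans <|
  single_le_sum (f := fun _ => ∑ _ ∈ range T, _)
    (fun d _ => sum_nonneg fun e _ => correlation_summand_nonneg hm p q d e) (mem_range.2 hd)

variable [IsFiniteMeasure μ]

lemma sum_measureReal_eq {f : Ω → ZMod N} (hf : Measurable f) :
    ∑ a, μ.real {ω | f ω = a} = μ.real Set.univ := by
  have := measureReal_eq_sum_fiber (μ := μ) hf fun _ => True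
  simpa only [true_and, Set.ofPred_true] using this.symm

lemma sum_mul_le_mul {f g : ZMod N → ℝ} {c : ℝ} (hf : ∀ v, 0 ≤ f v) (hg : ∀ v, g v ≤ c) :
    ∑ v, f v * g v ≤ (∑ v, f v) * c := by
  rw [sum_mul]
  exact sum_le_sum fun v _ => mul_le_mul_of_nonneg_left (hg v) (hf v)

lemma measureReal_collision_ge (h : IsMarkovTraj μ (rhoMatrix N x) X)
    (hX : ∀ n, Measurable (X n)) {l : ℝ} {i k : ℕ} (hl : ∀ a, l ≤ (rhoMatrix N x ^ k) a a) :
    l * μ.real Set.univ ≤ μ.real {ω | X i ω = X (i + k) ω} := by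
  rw [measureReal_eq_sum_fiber (hX i), ← sum_measureReal_eq (hX i), mul_sum]
  refine sum_le_sum fun a _ => ?_
  have e : {ω | X i ω = X (i + k) ω ∧ X i ω = a} = {ω | X i ω = a ∧ X (i + k) ω = a} := by
    ext ω
    constructor
    · rintro ⟨h1, h2⟩; exact ⟨h2, h1 ▸ h2⟩
    · rintro ⟨h1, h2⟩; exact ⟨h1.trans h2.symm, h1⟩
  rw [e, h.two_times hX, mul_comm]
  exact mul_le_mul_of_nonneg_left (hl a) measureReal_nonneg

lemma measureReal_disjoint_le (h : IsMarkovTraj μ (rhoMatrix N x) X)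
    (hX : ∀ n, Measurable (X n)) (hm : ∀ t, T ≤ t → ∀ u v, (rhoMatrix N x ^ t) u v ≤ m)
    {d e : ℕ} (hd : T ≤ d) (he : T ≤ e) (i f : ℕ) :
    μ.real {ω | X i ω = X (i + d) ω ∧ X (i + d + f) ω = X (i + d + f + e) ω} ≤
      m ^ 2 * μ.real Set.univ := by
  have hm0 : 0 ≤ m := (rhoMatrix_pow_nonneg T 0 0).trans (hm T le_rfl 0 0)
  rw [measureReal_eq_sum_fiber (hX i), ← sum_measureReal_eq (hX i), mul_sum]
  refine sum_le_sum fun a _ => ?_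
  rw [measureReal_eq_sum_fiber (hX (i + d + f))]
  have e1 : ∀ c, {ω | ((X i ω = X (i + d) ω ∧ X (i + d + f) ω = X (i + d + f + e) ω) ∧ X i ω = a) ∧
      X (i + d + f) ω = c} = {ω | ((X i ω = a ∧ X (i + d) ω = a) ∧ X (i + d + f) ω = c) ∧
        X (i + d + f + e) ω = c} := fun c => by
    ext ω
    simp only [Set.mem_ofPred_eq]
    grind
  simp only [e1, h.four_times hX, ← mul_sum]
  rw [mul_comm]
  refine mul_le_mul_of_nonneg_right ?_ measureReal_nonneg
  calc ∑ c, (rhoMatrix N x ^ d) a a * (rhoMatrix N x ^ f) a c * (rhoMatrix N x ^ e) c c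
      ≤ (∑ c, (rhoMatrix N x ^ d) a a * (rhoMatrix N x ^ f) a c) * m :=
        sum_mul_le_mul (fun c => mul_nonneg (rhoMatrix_pow_nonneg _ _ _)
          (rhoMatrix_pow_nonneg _ _ _)) fun c => hm e he c c
    _ = (rhoMatrix N x ^ d) a a * m := by rw [← mul_sum, sum_rhoMatrix_pow_right, mul_one]
    _ ≤ m ^ 2 := by rw [sq]; exact mul_le_mul_of_nonneg_right (hm d hd a a) hm0

lemma measureReal_overlap_le (h : IsMarkovTraj μ (rhoMatrix N x) X) (hN : Odd N)
    (hX : ∀ n, Measurable (X n)) (hm : ∀ t, T ≤ t → ∀ u v, (rhoMatrix N x ^ t) u v ≤ m)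
    {d e f : ℕ} (hdf : 2 * T ≤ d + f) (hef : 2 * T ≤ f + e) (i : ℕ) :
    μ.real {ω | X i ω = X (i + d + f) ω ∧ X (i + d) ω = X (i + d + f + e) ω} ≤
      m ^ 2 * μ.real Set.univ + if d < T ∧ e < T then
        m * ∑ a, μ.real {ω | X i ω = a} *
          ∑ c, (rhoMatrix N x ^ d) a c * (rhoMatrix N x ^ e) a c else 0 := by
  have hm0 : 0 ≤ m := (rhoMatrix_pow_nonneg T 0 0).trans (hm T le_rfl 0 0)
  have hP := fun t a c => rhoMatrix_pow_nonneg (x := x) t a c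
  rw [measureReal_eq_sum_fiber (hX i)]
  have e1 : ∀ a c, {ω | ((X i ω = X (i + d + f) ω ∧ X (i + d) ω = X (i + d + f + e) ω) ∧ X i ω = a) ∧
      X (i + d) ω = c} = {ω | ((X i ω = a ∧ X (i + d) ω = c) ∧ X (i + d + f) ω = a) ∧
        X (i + d + f + e) ω = c} := fun a c => by
    ext ω
    simp only [Set.mem_ofPred_eq]
    grind
  have e2 : ∀ a, μ.real {ω | (X i ω = X (i + d + f) ω ∧ X (i + d) ω = X (i + d + f + e) ω) ∧
      X i ω = a} = μ.real {ω | X i ω = a} * ∑ c, (rhoMatrix N x ^ d) a c *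
        (rhoMatrix N x ^ f) c a * (rhoMatrix N x ^ e) a c := fun a => by
    rw [measureReal_eq_sum_fiber (hX (i + d)), mul_sum]
    simp only [e1, h.four_times hX]
  simp only [e2]
  rw [← sum_measureReal_eq (hX i), mul_comm (m ^ 2), sum_mul]
  split_ifs with hT
  · rw [mul_sum, ← sum_add_distrib]
    refine sum_le_sum fun a _ => ?_
    have : ∑ c, (rhoMatrix N x ^ d) a c * (rhoMatrix N x ^ f) c a * (rhoMatrix N x ^ e) a c ≤
        (∑ c, (rhoMatrix N x ^ d) a c * (rhoMatrix N x ^ e) a c) * m := by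
      simp only [mul_right_comm]
      exact sum_mul_le_mul (fun c => mul_nonneg (hP _ _ _) (hP _ _ _)) fun c => hm f (by omega) c a
    have h0 := measureReal_nonneg (μ := μ) (s := {ω | X i ω = a})
    have := mul_le_mul_of_nonneg_left this h0
    have := mul_nonneg h0 (sq_nonneg m)
    linarith
  · rw [add_zero]
    refine sum_le_sum fun a _ => mul_le_mul_of_nonneg_left ?_ measureReal_nonneg
    rcases lt_or_ge f T with hf | hf
    · calc ∑ c, (rhoMatrix N x ^ d) a c * (rhoMatrix N x ^ f) c a * (rhoMatrix N x ^ e) a c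
          ≤ ∑ c, (rhoMatrix N x ^ f) c a * m ^ 2 := by
            refine sum_le_sum fun c _ => ?_
            rw [mul_comm ((rhoMatrix N x ^ d) a c), mul_assoc, sq]
            exact mul_le_mul_of_nonneg_left
              (mul_le_mul (hm d (by omega) a c) (hm e (by omega) a c) (hP _ _ _) hm0) (hP _ _ _)
        _ = m ^ 2 := by rw [← sum_mul, sum_rhoMatrix_pow_left hN, one_mul]
    · rcases le_or_gt T d with hd | hd
      · calc ∑ c, (rhoMatrix N x ^ d) a c * (rhoMatrix N x ^ f) c a * (rhoMatrix N x ^ e) a c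
            ≤ ∑ c, (rhoMatrix N x ^ e) a c * m ^ 2 := by
              refine sum_le_sum fun c _ => ?_
              rw [mul_comm _ ((rhoMatrix N x ^ e) a c), sq]
              exact mul_le_mul_of_nonneg_left
                (mul_le_mul (hm d hd a c) (hm f hf c a) (hP _ _ _) hm0) (hP _ _ _)
          _ = m ^ 2 := by rw [← sum_mul, sum_rhoMatrix_pow_right, one_mul]
      · calc ∑ c, (rhoMatrix N x ^ d) a c * (rhoMatrix N x ^ f) c a * (rhoMatrix N x ^ e) a c
            ≤ ∑ c, (rhoMatrix N x ^ d) a c * m ^ 2 := by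
              refine sum_le_sum fun c _ => ?_
              rw [mul_assoc, sq]
              exact mul_le_mul_of_nonneg_left
                (mul_le_mul (hm f hf c a) (hm e (by omega) a c) (hP _ _ _) hm0) (hP _ _ _)
          _ = m ^ 2 := by rw [← sum_mul, sum_rhoMatrix_pow_right, one_mul]

lemma measureReal_nested_le (h : IsMarkovTraj μ (rhoMatrix N x) X) (hN : Odd N)
    (hX : ∀ n, Measurable (X n)) (hm : ∀ t, T ≤ t → ∀ u v, (rhoMatrix N x ^ t) u v ≤ m)
    {d e f : ℕ} (hf : T ≤ f) (i : ℕ) :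
    μ.real {ω | X i ω = X (i + d + f + e) ω ∧ X (i + d) ω = X (i + d + f) ω} ≤
      m ^ 2 * μ.real Set.univ + if d < T ∧ e < T then
        m * ∑ a, μ.real {ω | X i ω = a} *
          ∑ c, (rhoMatrix N x ^ d) a c * (rhoMatrix N x ^ e) c a else 0 := by
  have hm0 : 0 ≤ m := (rhoMatrix_pow_nonneg T 0 0).trans (hm T le_rfl 0 0)
  have hP := fun t a c => rhoMatrix_pow_nonneg (x := x) t a c
  rw [measureReal_eq_sum_fiber (hX i)]
  have e1 : ∀ a c, {ω | ((X i ω = X (i + d + f + e) ω ∧ X (i + d) ω = X (i + d + f) ω) ∧ X i ω = a) ∧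
      X (i + d) ω = c} = {ω | ((X i ω = a ∧ X (i + d) ω = c) ∧ X (i + d + f) ω = c) ∧
        X (i + d + f + e) ω = a} := fun a c => by
    ext ω
    simp only [Set.mem_ofPred_eq]
    grind
  have e2 : ∀ a, μ.real {ω | (X i ω = X (i + d + f + e) ω ∧ X (i + d) ω = X (i + d + f) ω) ∧
      X i ω = a} = μ.real {ω | X i ω = a} * ∑ c, (rhoMatrix N x ^ d) a c *
        (rhoMatrix N x ^ f) c c * (rhoMatrix N x ^ e) c a := fun a => by
    rw [measureReal_eq_sum_fiber (hX (i + d)), mul_sum]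
    simp only [e1, h.four_times hX]
  simp only [e2]
  rw [← sum_measureReal_eq (hX i), mul_comm (m ^ 2), sum_mul]
  split_ifs with hT
  · rw [mul_sum, ← sum_add_distrib]
    refine sum_le_sum fun a _ => ?_
    have : ∑ c, (rhoMatrix N x ^ d) a c * (rhoMatrix N x ^ f) c c * (rhoMatrix N x ^ e) c a ≤
        (∑ c, (rhoMatrix N x ^ d) a c * (rhoMatrix N x ^ e) c a) * m := by
      simp only [mul_right_comm]
      exact sum_mul_le_mul (fun c => mul_nonneg (hP _ _ _) (hP _ _ _)) fun c => hm f hf c c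
    have h0 := measureReal_nonneg (μ := μ) (s := {ω | X i ω = a})
    have := mul_le_mul_of_nonneg_left this h0
    have := mul_nonneg h0 (sq_nonneg m)
    linarith
  · rw [add_zero]
    refine sum_le_sum fun a _ => mul_le_mul_of_nonneg_left ?_ measureReal_nonneg
    rcases le_or_gt T d with hd | hd
    · calc ∑ c, (rhoMatrix N x ^ d) a c * (rhoMatrix N x ^ f) c c * (rhoMatrix N x ^ e) c a
          ≤ ∑ c, (rhoMatrix N x ^ e) c a * m ^ 2 := by
            refine sum_le_sum fun c _ => ?_
            rw [mul_comm _ ((rhoMatrix N x ^ e) c a), sq]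
            exact mul_le_mul_of_nonneg_left
              (mul_le_mul (hm d hd a c) (hm f hf c c) (hP _ _ _) hm0) (hP _ _ _)
        _ = m ^ 2 := by rw [← sum_mul, sum_rhoMatrix_pow_left hN, one_mul]
    · calc ∑ c, (rhoMatrix N x ^ d) a c * (rhoMatrix N x ^ f) c c * (rhoMatrix N x ^ e) c a
          ≤ ∑ c, (rhoMatrix N x ^ d) a c * m ^ 2 := by
            refine sum_le_sum fun c _ => ?_
            rw [mul_assoc, sq]
            exact mul_le_mul_of_nonneg_left
              (mul_le_mul (hm f hf c c) (hm e (by omega) c a) (hP _ _ _) hm0) (hP _ _ _)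
        _ = m ^ 2 := by rw [← sum_mul, sum_rhoMatrix_pow_right, one_mul]

lemma measureReal_collision_inter_le (h : IsMarkovTraj μ (rhoMatrix N x) X) (hN : Odd N)
    (hX : ∀ n, Measurable (X n)) (hm : ∀ t, T ≤ t → ∀ u v, (rhoMatrix N x ^ t) u v ≤ m)
    {p q : ℕ × ℕ} (hp : p.1 + 2 * T ≤ p.2) (hq : q.1 + 2 * T ≤ q.2) (hpq : p.1 ≤ q.1) :
    μ.real ({ω | X p.1 ω = X p.2 ω} ∩ {ω | X q.1 ω = X q.2 ω}) ≤
      m ^ 2 * μ.real Set.univ + correlation μ x X m T p q := by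
  have hm0 : 0 ≤ m := (rhoMatrix_pow_nonneg T 0 0).trans (hm T le_rfl 0 0)
  have hc := correlation_nonneg (μ := μ) (x := x) (X := X) (T := T) hm0 p q
  have hsum := fun d e => summand_le_correlation (μ := μ) (x := x) (X := X) (T := T) hm0 p q
    (d := d) (e := e)
  obtain ⟨i, j⟩ := p
  obtain ⟨i', j'⟩ := q
  simp only at hp hq hpq hsum ⊢
  change μ.real {ω | X i ω = X j ω ∧ X i' ω = X j' ω} ≤ _
  obtain ⟨d, rfl⟩ := Nat.exists_eq_add_of_le hpq
  rcases le_total j (i + d) with hj | hj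
  · obtain ⟨k, rfl⟩ := Nat.exists_eq_add_of_le (show i ≤ j by omega)
    obtain ⟨f, hf⟩ := Nat.exists_eq_add_of_le hj
    obtain ⟨e, rfl⟩ := Nat.exists_eq_add_of_le (show i + d ≤ j' by omega)
    have := measureReal_disjoint_le h hX hm (d := k) (e := e) (by omega) (by omega) i f
    rw [← hf] at this
    linarith
  obtain ⟨f, rfl⟩ := Nat.exists_eq_add_of_le hj
  rcases le_total (i + d + f) j' with hj' | hj'
  · obtain ⟨e, rfl⟩ := Nat.exists_eq_add_of_le hj'
    refine (measureReal_overlap_le h hN hX hm (by omega) (by omega) i).trans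
      (add_le_add_right ?_ _)
    split_ifs with hT
    · refine le_trans ?_ (hsum d e hT.1 hT.2)
      rw [if_pos rfl]
      have := nestedWeight_nonneg (μ := μ) (x := x) (X := X) hm0 i d e
      exact le_add_of_nonneg_right (by positivity)
    · exact hc
  · obtain ⟨f', rfl⟩ := Nat.exists_eq_add_of_le (show i + d ≤ j' by omega)
    obtain ⟨e, he⟩ := Nat.exists_eq_add_of_le hj'
    rw [he] at hsum hc ⊢
    refine (measureReal_nested_le h hN hX hm (by omega) i).trans (add_le_add_right ?_ _)
    split_ifs with hT
    · refine le_trans ?_ (hsum d e hT.1 hT.2)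
      rw [Nat.add_sub_cancel, if_pos (rfl : ((i + d, i + d + f') : ℕ × ℕ) = _)]
      have := overlapWeight_nonneg (μ := μ) (x := x) (X := X) hm0 i d e
      exact le_add_of_nonneg_left (by positivity)
    · exact hc

lemma sum_sum_weight (A : Finset ℕ) (w : ZMod N → ℝ) (f g : ℕ → ZMod N → ZMod N → ℝ) :
    ∑ d ∈ A, ∑ e ∈ A, ∑ a, w a * ∑ c, f d a c * g e a c =
      ∑ a, w a * ∑ c, (∑ d ∈ A, f d a c) * ∑ e ∈ A, g e a c := by
  rw [sum_congr rfl fun d _ => sum_comm, sum_comm]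
  refine sum_congr rfl fun a _ => ?_
  simp only [← mul_sum, sum_mul_sum]
  rw [sum_congr rfl fun d _ => sum_comm, sum_comm]
  simp only [mul_sum]

lemma sum_overlapWeight_le (hX : ∀ n, Measurable (X n)) (hm : 0 ≤ m) {C : ℝ}
    (hC : ∀ a, ∑ c, green N x T a c * green N x T a c ≤ C) (i : ℕ) :
    ∑ d ∈ range T, ∑ e ∈ range T, overlapWeight μ x X m i d e ≤ m * (C * μ.real Set.univ) := by
  simp only [overlapWeight, ← mul_sum]
  rw [sum_sum_weight (range T) _ (fun d => rhoMatrix N x ^ d) (fun e => rhoMatrix N x ^ e),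
    mul_comm C, ← sum_measureReal_eq (hX i)]
  exact mul_le_mul_of_nonneg_left (sum_mul_le_mul (fun _ => measureReal_nonneg) hC) hm

lemma sum_nestedWeight_le (hX : ∀ n, Measurable (X n)) (hm : 0 ≤ m) {C : ℝ}
    (hC : ∀ a, ∑ c, green N x T a c * green N x T c a ≤ C) (i : ℕ) :
    ∑ d ∈ range T, ∑ e ∈ range T, nestedWeight μ x X m i d e ≤ m * (C * μ.real Set.univ) := by
  simp only [nestedWeight, ← mul_sum]
  rw [sum_sum_weight (range T) _ (fun d => rhoMatrix N x ^ d) (fun e a c => (rhoMatrix N x ^ e) c a),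
    mul_comm C, ← sum_measureReal_eq (hX i)]
  exact mul_le_mul_of_nonneg_left (sum_mul_le_mul (fun _ => measureReal_nonneg) hC) hm

lemma sum_correlation_le (hX : ∀ n, Measurable (X n)) (hm : 0 ≤ m) {C₁ C₂ : ℝ}
    (hC₁ : ∀ a, ∑ c, green N x T a c * green N x T a c ≤ C₁)
    (hC₂ : ∀ a, ∑ c, green N x T a c * green N x T c a ≤ C₂) (I : Finset (ℕ × ℕ)) (p : ℕ × ℕ) :
    ∑ q ∈ I, correlation μ x X m T p q ≤ m * ((C₁ + C₂) * μ.real Set.univ) := by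
  have hcomm : ∑ q ∈ I, correlation μ x X m T p q = ∑ d ∈ range T, ∑ e ∈ range T, ∑ q ∈ I,
      ((if q = (p.1 + d, p.2 + e) then overlapWeight μ x X m p.1 d e else 0) +
        if q = (p.1 + d, p.2 - e) then nestedWeight μ x X m p.1 d e else 0) := by
    unfold correlation
    rw [sum_comm]
    exact sum_congr rfl fun d _ => sum_comm
  calc ∑ q ∈ I, correlation μ x X m T p q
      ≤ ∑ d ∈ range T, ∑ e ∈ range T,
          (overlapWeight μ x X m p.1 d e + nestedWeight μ x X m p.1 d e) := by
        rw [hcomm]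
        refine sum_le_sum fun d _ => sum_le_sum fun e _ => ?_
        rw [sum_add_distrib, sum_ite_eq', sum_ite_eq']
        have h1 := overlapWeight_nonneg (μ := μ) (x := x) (X := X) hm p.1 d e
        have h2 := nestedWeight_nonneg (μ := μ) (x := x) (X := X) hm p.1 d e
        gcongr <;> split_ifs <;> first | exact le_rfl | assumption
    _ ≤ _ := by
        have h1 := sum_overlapWeight_le (μ := μ) hX hm hC₁ p.1
        have h2 := sum_nestedWeight_le (μ := μ) hX hm hC₂ p.1
        simp only [sum_add_distrib]
        linarith

/-- The probability of no collision within a family of well-separated pairs of times. -/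
lemma measureReal_no_collision_le (h : IsMarkovTraj μ (rhoMatrix N x) X) (hN : Odd N)
    (hX : ∀ n, Measurable (X n)) {l C₁ C₂ : ℝ}
    (hm : ∀ t, T ≤ t → ∀ u v, (rhoMatrix N x ^ t) u v ≤ m)
    (hl : ∀ t, T ≤ t → ∀ u v, l ≤ (rhoMatrix N x ^ t) u v)
    (hC₁ : ∀ a, ∑ c, green N x T a c * green N x T a c ≤ C₁)
    (hC₂ : ∀ a, ∑ c, green N x T a c * green N x T c a ≤ C₂)
    {I : Finset (ℕ × ℕ)} (hI : ∀ p ∈ I, p.1 + 2 * T ≤ p.2) {θ : ℝ} (hθ : 0 ≤ θ) :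
    μ.real {ω | ∀ p ∈ I, X p.1 ω ≠ X p.2 ω} ≤
      (1 - 2 * θ * (#I * l) + θ ^ 2 * (#I ^ 2 * m ^ 2 + 2 * #I * (m * (C₁ + C₂)))) *
        μ.real Set.univ := by
  have hm0 : 0 ≤ m := (rhoMatrix_pow_nonneg T 0 0).trans (hm T le_rfl 0 0)
  have hE : ∀ p : ℕ × ℕ, MeasurableSet {ω | X p.1 ω = X p.2 ω} := fun p =>
    measurableSet_eq_fun (hX _) (hX _)
  have h1 : #I * (l * μ.real Set.univ) ≤ ∑ p ∈ I, μ.real {ω | X p.1 ω = X p.2 ω} := by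
    rw [← nsmul_eq_mul]
    refine card_nsmul_le_sum _ _ _ fun p hp => ?_
    obtain ⟨k, hk⟩ := Nat.exists_eq_add_of_le ((Nat.le_add_right _ _).trans (hI p hp))
    have := hI p hp
    rw [hk]
    exact measureReal_collision_ge h hX fun a => hl k (by omega) a a
  have hpair : ∀ p ∈ I, ∀ q ∈ I,
      μ.real ({ω | X p.1 ω = X p.2 ω} ∩ {ω | X q.1 ω = X q.2 ω}) ≤
        m ^ 2 * μ.real Set.univ + correlation μ x X m T p q + correlation μ x X m T q p := by
    intro p hp q hq
    have c1 := correlation_nonneg (μ := μ) (x := x) (X := X) (T := T) hm0 p q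
    have c2 := correlation_nonneg (μ := μ) (x := x) (X := X) (T := T) hm0 q p
    rcases le_total p.1 q.1 with hpq | hpq
    · have := measureReal_collision_inter_le h hN hX hm (hI p hp) (hI q hq) hpq
      linarith
    · have := measureReal_collision_inter_le h hN hX hm (hI q hq) (hI p hp) hpq
      rw [Set.inter_comm]
      linarith
  have h2 : ∑ p ∈ I, ∑ q ∈ I, μ.real ({ω | X p.1 ω = X p.2 ω} ∩ {ω | X q.1 ω = X q.2 ω}) ≤
      (#I ^ 2 * m ^ 2 + 2 * #I * (m * (C₁ + C₂))) * μ.real Set.univ := by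
    have h3 : ∑ p ∈ I, ∑ q ∈ I, correlation μ x X m T p q ≤
        #I * (m * ((C₁ + C₂) * μ.real Set.univ)) := by
      rw [← nsmul_eq_mul]
      exact sum_le_card_nsmul _ _ _ fun p _ => sum_correlation_le hX hm0 hC₁ hC₂ I p
    refine (sum_le_sum fun p hp => sum_le_sum fun q hq => hpair p hp q hq).trans ?_
    simp only [sum_add_distrib, sum_const, nsmul_eq_mul]
    rw [sum_comm (f := fun p q => correlation μ x X m T q p)]
    linarith
  have h4 := measureReal_forall_notMem_le (μ := μ) I hE θ
  have h5 := mul_le_mul_of_nonneg_left h1 hθ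
  have h6 := mul_le_mul_of_nonneg_left h2 (sq_nonneg θ)
  refine h4.trans ?_
  linarith

end SecondMoment

/-! ### Renewal over disjoint time windows and asymptotics -/

section Renewal

lemma exists_separated_pairs (T V : ℕ) :
    ∃ I : Finset (ℕ × ℕ), (∀ p ∈ I, p.1 + 2 * T ≤ p.2 ∧ p.2 < V + 2 * T) ∧ V ^ 2 ≤ 2 * #I := by
  refine ⟨((range V).sigma fun k => range (k + 1)).image fun s => (s.2, s.1 + 2 * T), ?_, ?_⟩
  · intro p hp
    obtain ⟨⟨k, i⟩, hs, rfl⟩ := mem_image.1 hp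
    simp only [mem_sigma, mem_range] at hs
    simp only
    omega
  · rw [card_image_of_injective, card_sigma]
    · simp only [card_range]
      induction V with
      | zero => simp
      | succ V ih => rw [sum_range_succ]; nlinarith
    · rintro ⟨k, i⟩ ⟨k', i'⟩ h
      simp only [Prod.mk.injEq, Nat.add_right_cancel_iff] at h
      obtain ⟨rfl, rfl⟩ := h
      rfl

variable {N : ℕ} [NeZero N] {x : ZMod N} {Ω : Type*} [MeasurableSpace Ω] {μ : Measure Ω}
  {X : ℕ → Ω → ZMod N} {T V : ℕ}

lemma measureReal_injective_window_le [IsFiniteMeasure μ] (h : IsMarkovTraj μ (rhoMatrix N x) X)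
    (hN : Odd N) (hX : ∀ n, Measurable (X n)) (hT : 0 < T)
    (hmix : ∀ u v, |(rhoMatrix N x ^ T) u v - 1 / N| ≤ 1 / (100 * N)) {C₁ C₂ : ℝ}
    (hC₁ : ∀ a, ∑ c, green N x T a c * green N x T a c ≤ C₁)
    (hC₂ : ∀ a, ∑ c, green N x T a c * green N x T c a ≤ C₂) (hC : C₁ + C₂ ≤ 145)
    (hV : 550 * (N : ℝ) ≤ V ^ 2) :
    μ.real {ω | ∀ i j, i < j → j < V + 2 * T → X i ω ≠ X j ω} ≤
      53 / 100 * μ.real Set.univ := by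
  have hN0 : (0 : ℝ) < N := Nat.cast_pos.2 (NeZero.pos N)
  obtain ⟨I, hI, hcard⟩ := exists_separated_pairs T V
  have hq : 275 * (N : ℝ) ≤ #I := by
    have : (V : ℝ) ^ 2 ≤ 2 * #I := by exact_mod_cast hcard
    linarith
  set q : ℝ := ((#I : ℕ) : ℝ) with hqdef
  have hq0 : 0 < q := by linarith
  have hmix' := fun t (ht : T ≤ t) u v => abs_le.1 (abs_rhoMatrix_pow_sub_le_of_le ht hmix u v)
  have hm : ∀ t, T ≤ t → ∀ u v, (rhoMatrix N x ^ t) u v ≤ 101 / 100 / N := fun t ht u v => by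
    have := (hmix' t ht u v).2
    rw [div_mul_eq_div_div] at this
    have e : (101 / 100 / N : ℝ) = 1 / 100 / N + 1 / N := by ring
    linarith
  have hl : ∀ t, T ≤ t → ∀ u v, 99 / 100 / (N : ℝ) ≤ (rhoMatrix N x ^ t) u v := fun t ht u v => by
    have := (hmix' t ht u v).1
    rw [div_mul_eq_div_div] at this
    have e : (99 / 100 / N : ℝ) = 1 / N - 1 / 100 / N := by ring
    linarith
  set θ : ℝ := (99 / 100 * N) / (q * (101 / 100) ^ 2 + 2 * (101 / 100 * 145) * N) with hθ
  have hθ0 : 0 ≤ θ := by positivity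
  have key := measureReal_no_collision_le h hN hX hm hl hC₁ hC₂ (fun p hp => (hI p hp).1) hθ0
  rw [← hqdef] at key
  have hsub : μ.real {ω | ∀ i j, i < j → j < V + 2 * T → X i ω ≠ X j ω} ≤
      μ.real {ω | ∀ p ∈ I, X p.1 ω ≠ X p.2 ω} :=
    measureReal_mono fun ω H p hp => H p.1 p.2 (by have := (hI p hp).1; omega) (hI p hp).2
  refine (hsub.trans key).trans (mul_le_mul_of_nonneg_right ?_ measureReal_nonneg)
  have h1 : θ ^ 2 * (q ^ 2 * (101 / 100 / N) ^ 2 + 2 * q * (101 / 100 / N * (C₁ + C₂))) ≤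
      θ ^ 2 * (q ^ 2 * (101 / 100 / N) ^ 2 + 2 * q * (101 / 100 / N * 145)) := by gcongr
  have h2 : θ ^ 2 * (q ^ 2 * (101 / 100 / N) ^ 2 + 2 * q * (101 / 100 / N * 145)) =
      θ * (q * (99 / 100 / N)) := by
    rw [hθ]
    field_simp
  have h3 : 47 / 100 ≤ θ * (q * (99 / 100 / N)) := by
    rw [hθ]
    rw [show 99 / 100 * (N : ℝ) / (q * (101 / 100) ^ 2 + 2 * (101 / 100 * 145) * N) *
      (q * (99 / 100 / N)) = (99 / 100) ^ 2 * q / (q * (101 / 100) ^ 2 + 2 * (101 / 100 * 145) * N)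
      by field_simp, le_div_iff₀ (by positivity)]
    linarith
  linarith

lemma measureReal_injective_add_le [IsFiniteMeasure μ] (h : IsMarkovTraj μ (rhoMatrix N x) X)
    (hN : Odd N) (hX : ∀ n, Measurable (X n)) (hT : 0 < T)
    (hmix : ∀ u v, |(rhoMatrix N x ^ T) u v - 1 / N| ≤ 1 / (100 * N)) {C₁ C₂ : ℝ}
    (hC₁ : ∀ a, ∑ c, green N x T a c * green N x T a c ≤ C₁)
    (hC₂ : ∀ a, ∑ c, green N x T a c * green N x T c a ≤ C₂) (hC : C₁ + C₂ ≤ 145)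
    (hV : 550 * (N : ℝ) ≤ V ^ 2) (n : ℕ) :
    μ.real {ω | ∀ i j, i < j → j ≤ n + (V + 2 * T) → X i ω ≠ X j ω} ≤
      53 / 100 * μ.real {ω | ∀ i j, i < j → j ≤ n → X i ω ≠ X j ω} := by
  have hQ : DependsOn (fun z : ℕ → ZMod N => ∀ i j, i < j → j ≤ n → z i ≠ z j) (Set.Iic n) := by
    intro z w hzw
    refine propext (forall₄_congr fun i j hij hj => ?_)
    rw [hzw i (hij.le.trans hj), hzw j hj]
  have key := measureReal_injective_window_le (h.restrict_shift hX hQ) hN (fun k => hX (n + k)) hT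
    hmix hC₁ hC₂ hC hV
  rw [measureReal_restrict_apply .univ, Set.univ_inter] at key
  refine le_trans ?_ key
  refine (measureReal_mono ?_).trans (ENNReal.toReal_mono (measure_ne_top _ _)
    (Measure.le_restrict_apply _ _))
  exact fun ω H => ⟨fun i j hij hj => H _ _ (by omega) (by omega),
    fun i j hij hj => H i j hij (by omega)⟩

/-- Geometric decay along steps of length `W` bounds the total sum. -/
lemma sum_range_mul_le {D : ℕ → ℝ} {W : ℕ} {r : ℝ} (hr0 : 0 ≤ r) (hr1 : r < 1) (h1 : ∀ n, D n ≤ 1)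
    (hD : ∀ n, D (n + W) ≤ r * D n) (k : ℕ) : ∑ n ∈ range (k * W), D n ≤ W / (1 - r) := by
  have hr : 0 < 1 - r := by linarith
  induction k with
  | zero => rw [zero_mul, range_zero, sum_empty]; positivity
  | succ k ih =>
    rw [add_mul, one_mul, add_comm, sum_range_add]
    have i1 : ∑ n ∈ range W, D n ≤ W := by
      simpa using sum_le_card_nsmul (range W) D 1 fun n _ => h1 n
    have i2 : ∑ n ∈ range (k * W), D (W + n) ≤ r * ∑ n ∈ range (k * W), D n := by
      rw [mul_sum]
      exact sum_le_sum fun n _ => by rw [add_comm]; exact hD n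
    have i3 := mul_le_mul_of_nonneg_left ih hr0
    have e : (W : ℝ) + r * (W / (1 - r)) = W / (1 - r) := by field_simp; ring
    linarith

lemma tsum_measure_injective_le [IsProbabilityMeasure μ] (h : IsMarkovTraj μ (rhoMatrix N x) X)
    (hN : Odd N) (hX : ∀ n, Measurable (X n)) (hT : 0 < T)
    (hmix : ∀ u v, |(rhoMatrix N x ^ T) u v - 1 / N| ≤ 1 / (100 * N)) {C₁ C₂ : ℝ}
    (hC₁ : ∀ a, ∑ c, green N x T a c * green N x T a c ≤ C₁)
    (hC₂ : ∀ a, ∑ c, green N x T a c * green N x T c a ≤ C₂) (hC : C₁ + C₂ ≤ 145)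
    (hV : 550 * (N : ℝ) ≤ V ^ 2) :
    ∑' n : ℕ, μ {ω | ∀ i j, i < j → j ≤ n → X i ω ≠ X j ω} ≤
      ENNReal.ofReal ((V + 2 * T) / (1 - 53 / 100)) := by
  refine ENNReal.tsum_le_of_sum_range_le fun n => ?_
  set D : ℕ → ℝ := fun n => μ.real {ω | ∀ i j, i < j → j ≤ n → X i ω ≠ X j ω} with hDdef
  have hD0 : ∀ n, 0 ≤ D n := fun n => measureReal_nonneg
  have hW : n ≤ n * (V + 2 * T) := Nat.le_mul_of_pos_right n (by omega)
  have key := sum_range_mul_le (D := D) (W := V + 2 * T) (by norm_num) (by norm_num)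
    (fun n => measureReal_le_one)
    (measureReal_injective_add_le h hN hX hT hmix hC₁ hC₂ hC hV) n
  push_cast at key
  have e : ∀ n, μ {ω | ∀ i j, i < j → j ≤ n → X i ω ≠ X j ω} = ENNReal.ofReal (D n) := fun n =>
    (ofReal_measureReal).symm
  simp only [e]
  rw [← ENNReal.ofReal_sum_of_nonneg fun n _ => hD0 n]
  exact ENNReal.ofReal_le_ofReal ((sum_le_sum_of_subset_of_nonneg (range_mono hW)
    fun n _ _ => hD0 n).trans key)

end Renewal

section Asymptotics

open Filter

/-- The mixing time is small compared with any power of `N`. -/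
lemma exists_mixing_time : ∃ N₀ : ℕ, ∀ N : ℕ, ∀ [NeZero N], N₀ ≤ N → Odd N → ∀ x : ZMod N,
    ∃ T : ℕ, 0 < T ∧ 648 * (T : ℝ) ^ 4 ≤ N ∧
      ∀ u v, |(rhoMatrix N x ^ T) u v - 1 / N| ≤ 1 / (100 * N) := by
  have hlim := (Real.isLittleO_pow_log_id_atTop (n := 8)).def
    (show (0 : ℝ) < 1 / (200 * (648 * 82948 ^ 4)) by norm_num)
  have hcast : Tendsto (fun N : ℕ => 200 * (N : ℝ)) atTop atTop :=
    tendsto_natCast_atTop_atTop.const_mul_atTop (by norm_num)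
  obtain ⟨N₀, hN₀⟩ := eventually_atTop.1 (hcast.eventually hlim)
  refine ⟨max 3 N₀, fun N _ hN hodd x => ?_⟩
  have hN3 : 3 ≤ N := (le_max_left _ _).trans hN
  have hlog := hN₀ N ((le_max_right _ _).trans hN)
  have hN' : (3 : ℝ) ≤ N := by exact_mod_cast hN3
  have hL : 1 ≤ Real.log (2 * N) := by
    rw [Real.le_log_iff_exp_le (by linarith)]
    linarith [Real.exp_one_lt_d9]
  have hLM : Real.log (2 * N) ≤ Real.log (200 * N) := Real.log_le_log (by linarith) (by linarith)
  set L := Real.log (2 * N) with hLdef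
  set M := Real.log (200 * N) with hMdef
  have hM : 1 ≤ M := hL.trans hLM
  have hL0 : 0 < L := one_pos.trans_le hL
  have hM0 : 0 < M := one_pos.trans_le hM
  set n := ⌈20736 * L * M⌉₊ with hn
  have hn1 : 20736 * L * M ≤ n := Nat.le_ceil _
  have hn2 : (n : ℝ) ≤ 20737 * M ^ 2 := by
    have := (Nat.ceil_lt_add_one (show 0 ≤ 20736 * L * M by positivity)).le
    rw [← hn] at this
    nlinarith
  have hn0 : 0 < n := by
    rw [hn]
    exact Nat.ceil_pos.2 (by positivity)
  refine ⟨2 * n, by omega, ?_, fun u v => ?_⟩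
  · have h1 : ‖M ^ 8‖ = M ^ 8 := Real.norm_of_nonneg (by positivity)
    have h2 : ‖id (200 * (N : ℝ))‖ = 200 * N :=
      Real.norm_of_nonneg (show 0 ≤ 200 * (N : ℝ) by positivity)
    rw [h1, h2] at hlog
    push_cast
    calc 648 * (2 * (n : ℝ)) ^ 4 ≤ 648 * (2 * (20737 * M ^ 2)) ^ 4 := by gcongr
      _ ≤ 648 * 82948 ^ 4 * M ^ 8 := by
        rw [show (2 * (20737 * M ^ 2)) ^ 4 = 41474 ^ 4 * M ^ 8 by ring]
        have : 0 ≤ M ^ 8 := by positivity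
        linarith
      _ ≤ N := by
        have := mul_le_mul_of_nonneg_left hlog (show (0 : ℝ) ≤ 648 * 82948 ^ 4 by norm_num)
        refine this.trans (le_of_eq ?_)
        field_simp
  · refine (abs_rhoMatrix_pow_sub_le hodd hN3 n u v).trans ?_
    rw [← hLdef]
    have h1 : 1 - (1 / 144 : ℝ) ^ 2 / L ≤ Real.exp (-((1 / 144) ^ 2 / L)) := by
      have := Real.add_one_le_exp (-((1 / 144 : ℝ) ^ 2 / L))
      linarith
    have h0 : 0 ≤ 1 - (1 / 144 : ℝ) ^ 2 / L := by
      have := div_le_self (show (0 : ℝ) ≤ (1 / 144) ^ 2 by positivity) hL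
      linarith
    calc 2 * (1 - (1 / 144 : ℝ) ^ 2 / L) ^ n ≤ 2 * Real.exp (-((1 / 144) ^ 2 / L)) ^ n := by gcongr
      _ = 2 * Real.exp (-(n * ((1 / 144) ^ 2 / L))) := by rw [← Real.exp_nat_mul]; ring_nf
      _ ≤ 2 * Real.exp (-M) := by
        gcongr
        have h2 : 20736 * L * M * ((1 / 144) ^ 2 / L) = M := by field_simp; norm_num
        rw [← h2]
        gcongr
      _ = 1 / (100 * N) := by
        rw [Real.exp_neg, hMdef, Real.exp_log (by linarith)]
        field_simp
        norm_num

lemma two_thirds_pow_log_sq_le {N : ℕ} (hN : N ≠ 0) :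
    ((2 / 3 : ℝ) ^ Nat.log 2 N) ^ 2 ≤ 2 / N := by
  have hN0 : (0 : ℝ) < N := Nat.cast_pos.2 (Nat.pos_of_ne_zero hN)
  have h : (N : ℝ) ≤ 2 ^ (Nat.log 2 N + 1) := by
    exact_mod_cast (Nat.lt_pow_succ_log_self one_lt_two N).le
  calc ((2 / 3 : ℝ) ^ Nat.log 2 N) ^ 2 = ((2 / 3) ^ 2) ^ Nat.log 2 N := by
        rw [← pow_mul, ← pow_mul, mul_comm]
    _ ≤ (1 / 2) ^ Nat.log 2 N := by gcongr; norm_num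
    _ = 2 / 2 ^ (Nat.log 2 N + 1) := by rw [one_div_pow, pow_succ]; field_simp
    _ ≤ 2 / N := by gcongr

end Asymptotics

/-- Expected collision time of the Pollard Rho walk is at most `(1+o(1))·12·√19·√N`.
The expectation `E[min{j ≥ 1 : Y_j ∈ {Y_0,…,Y_{j-1}}}]` is written as
`∑_{n≥0} Pr[Y_0,…,Y_n all distinct]`. -/
theorem pollard_rho_expected_collision_time (ε : ℝ) (hε : 0 < ε) :
    ∃ N₀ : ℕ, ∀ N : ℕ, N₀ ≤ N → N.Prime → Odd N → ∀ x : ZMod N,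
      ∀ (Ω : Type u) [MeasurableSpace Ω] (μ : Measure Ω),
        IsProbabilityMeasure μ →
        ∀ X : ℕ → Ω → ZMod N, (∀ n, Measurable (X n)) →
          ∀ y₀ : ZMod N, μ {ω | X 0 ω = y₀} = 1 →
            IsMarkovTraj μ (rhoMatrix N x) X →
            ∑' n : ℕ, μ {ω | ∀ i j, i < j → j ≤ n → X i ω ≠ X j ω}
              ≤ ENNReal.ofReal ((1 + ε) * 12 * Real.sqrt 19 * Real.sqrt N) := by
  obtain ⟨N₀, hN₀⟩ := exists_mixing_time
  refine ⟨max N₀ 1, fun N hN _ hodd x Ω _ μ _ X hX y₀ _ h => ?_⟩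
  have hN1 : N ≠ 0 := Nat.one_le_iff_ne_zero.1 ((le_max_right _ _).trans hN)
  have : NeZero N := ⟨hN1⟩
  obtain ⟨T, hT, hTN, hmix⟩ := hN₀ N ((le_max_left _ _).trans hN) hodd x
  have hN0 : (0 : ℝ) < N := Nat.cast_pos.2 (NeZero.pos N)
  have hT1 : (1 : ℝ) ≤ T := Nat.one_le_cast.2 hT
  have hsq : √(N : ℝ) ^ 2 = N := Real.sq_sqrt hN0.le
  have hs0 : 0 ≤ √(N : ℝ) := Real.sqrt_nonneg _
  have hTs : 2 * (T : ℝ) + 1 ≤ √N := by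
    refine Real.le_sqrt_of_sq_le (le_trans ?_ hTN)
    have : (T : ℝ) ^ 2 ≤ T ^ 4 := pow_le_pow_right₀ hT1 (by norm_num)
    nlinarith
  have hTS : 18 * (T : ℝ) ^ 2 * (2 / 3) ^ Nat.log 2 N ≤ 1 := by
    refine (sq_le_one_iff₀ (by positivity)).1 ?_
    calc (18 * (T : ℝ) ^ 2 * (2 / 3) ^ Nat.log 2 N) ^ 2
        = 324 * (T : ℝ) ^ 4 * ((2 / 3) ^ Nat.log 2 N) ^ 2 := by ring
      _ ≤ 324 * (T : ℝ) ^ 4 * (2 / N) :=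
          mul_le_mul_of_nonneg_left (two_thirds_pow_log_sq_le hN1) (by positivity)
      _ = 648 * (T : ℝ) ^ 4 / N := by ring
      _ ≤ 1 := div_le_one_of_le₀ hTN hN0.le
  have hS : 2 ^ Nat.log 2 N ≤ N := Nat.pow_log_le_self 2 hN1
  set V := ⌈47 / 2 * √(N : ℝ)⌉₊ with hVdef
  have hV1 : 47 / 2 * √(N : ℝ) ≤ V := Nat.le_ceil _
  have hV2 : (V : ℝ) < 47 / 2 * √(N : ℝ) + 1 := Nat.ceil_lt_add_one (by positivity)
  refine (tsum_measure_injective_le h hodd hX hT hmix (sum_green_sq_le hodd hS T)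
    (sum_green_mul_green_swap_le hodd hS T) (by linarith) (V := V) (by nlinarith)).trans
    (ENNReal.ofReal_le_ofReal ?_)
  have h19 : (435 / 100 : ℝ) ≤ √19 := Real.le_sqrt_of_sq_le (by norm_num)
  have h1 : ((V : ℝ) + 2 * T) / (1 - 53 / 100) ≤ 12 * √19 * √N := by
    rw [div_le_iff₀ (by norm_num)]
    nlinarith
  have h2 : 0 ≤ ε * (12 * √19 * √N) := by positivity
  linarith
end

section
/- Let B be the block walk on Z_N (N ≥ 3 odd, parameter x ∈ Z_N). If 1 ≤ s ≤ ⌊log₂ N⌋, then B^s(u,v) ≤ (2/3)^s for all u,v ∈ Z_N; and if s > ⌊log₂ N⌋, then B^s(u,v) ≤ (3/2)·N^{1 − log₂ 3} ≤ (3/2)/√N for all u,v ∈ Z_N. -/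
open Finset

/-- The block walk associated with the Pollard Rho walk on `Z_N`:
`B(u,v) = ∑_{k=0}^∞ (1/3)(1/3)^k ∑_{a=0}^k C(k,a)·1[2(u + a + (k−a)x) = v]`. -/
noncomputable def blockMatrix (N : ℕ) (x : ZMod N) : Matrix (ZMod N) (ZMod N) ℝ :=
  fun u v => ∑' k : ℕ, (1 / 3 : ℝ) * (1 / 3) ^ k *
    ∑ a ∈ Finset.range (k + 1),
      (k.choose a : ℝ) *
        (if 2 * (u + (a : ZMod N) + ((k - a : ℕ) : ZMod N) * x) = v then 1 else 0)

section Resolvent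

variable {G : Type*} [AddCommGroup G]

/-- A minimum principle: if `l f - a f(· - s) - b f(· - t)` is nonnegative, where `a, b ≥ 0`
and `a + b < l`, then `f` is nonnegative. -/
theorem nonneg_of_resolvent_nonneg [Finite G] {l a b : ℝ} (ha : 0 ≤ a) (hb : 0 ≤ b)
    (hl : a + b < l) (s t : G) {f : G → ℝ}
    (h : ∀ c, 0 ≤ l * f c - a * f (c - s) - b * f (c - t)) (c : G) : 0 ≤ f c := by
  obtain ⟨m, hm⟩ := Finite.exists_min f
  refine le_trans ?_ (hm c)
  have h1 := mul_le_mul_of_nonneg_left (hm (m - s)) ha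
  have h2 := mul_le_mul_of_nonneg_left (hm (m - t)) hb
  have h3 := h m
  by_contra! hneg
  nlinarith [mul_pos_of_neg_of_neg hneg (sub_neg.2 hl)]

theorem resolvent_injective [Finite G] {l a b : ℝ} (ha : 0 ≤ a) (hb : 0 ≤ b)
    (hl : a + b < l) (s t : G) {f g : G → ℝ}
    (h : ∀ c, l * f c - a * f (c - s) - b * f (c - t) =
      l * g c - a * g (c - s) - b * g (c - t)) : f = g := by
  funext c
  have h1 := nonneg_of_resolvent_nonneg ha hb hl s t (f := fun c => f c - g c)
    (fun c => by linarith [h c]) c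
  have h2 := nonneg_of_resolvent_nonneg ha hb hl s t (f := fun c => g c - f c)
    (fun c => by linarith [h c]) c
  linarith

theorem exists_resolvent_eq [Finite G] {l a b : ℝ} (ha : 0 ≤ a) (hb : 0 ≤ b)
    (hl : a + b < l) (s t : G) (h : G → ℝ) :
    ∃ f : G → ℝ, ∀ c, l * f c - a * f (c - s) - b * f (c - t) = h c := by
  let T : (G → ℝ) →ₗ[ℝ] (G → ℝ) :=
    { toFun := fun f c => l * f c - a * f (c - s) - b * f (c - t)
      map_add' := fun f g => by funext c; simp only [Pi.add_apply]; ring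
      map_smul' := fun r f => by
        funext c; simp only [Pi.smul_apply, smul_eq_mul, RingHom.id_apply]; ring }
  have hT : Function.Injective T := fun f g hfg =>
    resolvent_injective ha hb hl s t (fun c => congrFun hfg c)
  obtain ⟨f, hf⟩ := LinearMap.injective_iff_surjective.1 hT h
  exact ⟨f, fun c => congrFun hf c⟩

theorem sum_resolvent [Fintype G] (l a b : ℝ) (s t : G) (f : G → ℝ) :
    ∑ c, (l * f c - a * f (c - s) - b * f (c - t)) = (l - a - b) * ∑ c, f c := by
  have hs : ∀ s : G, ∑ c, f (c - s) = ∑ c, f c := fun s => (Equiv.subRight s).sum_comp f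
  simp only [Finset.sum_sub_distrib, ← Finset.mul_sum, hs]
  ring

/-- The solution `β` of `3 β - β(· - 1) - β(· - x) = δ₀` splits as `q + p + p(· - 1)`
with `p`, `q` nonnegative of total mass `1 / 3`. -/
theorem exists_fair_coin_decomposition [Fintype G] [DecidableEq G] (y x : G) {β : G → ℝ}
    (hβ : ∀ c, 3 * β c - β (c - y) - β (c - x) = if c = 0 then 1 else 0) :
    ∃ p q : G → ℝ, (∀ c, 0 ≤ p c) ∧ (∀ c, 0 ≤ q c) ∧ ∑ c, p c = 1 / 3 ∧ ∑ c, q c = 1 / 3 ∧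
      ∀ c, β c = q c + p c + p (c - y) := by
  obtain ⟨q, hq⟩ := exists_resolvent_eq (l := 9) (a := 1) (b := 2) (by norm_num) (by norm_num)
    (by norm_num) (y + y) x (fun c : G => if c = 0 then (2 : ℝ) else 0)
  have q_nonneg : ∀ c, 0 ≤ q c := nonneg_of_resolvent_nonneg (l := 9) (a := 1) (b := 2)
    (by norm_num) (by norm_num) (by norm_num) (y + y) x
    (fun c => by rw [hq]; split_ifs <;> norm_num)
  obtain ⟨r, hr⟩ := exists_resolvent_eq (l := 3) (a := 1) (b := 1) (by norm_num) (by norm_num)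
    (by norm_num) y x (fun c => q (c - x) / 2)
  have r_nonneg : ∀ c, 0 ≤ r c := nonneg_of_resolvent_nonneg (l := 3) (a := 1) (b := 1)
    (by norm_num) (by norm_num) (by norm_num) y x
    (fun c => by rw [hr]; linarith [q_nonneg (c - x)])
  have q_sum : ∑ c, q c = 1 / 3 := by
    have h := sum_resolvent 9 1 2 (y + y) x q
    simp only [hq, Finset.sum_ite_eq', Finset.mem_univ, if_true] at h
    linarith
  have r_sum : ∑ c, r c = 1 / 6 := by
    have h := sum_resolvent 3 1 1 y x r
    simp only [hr] at h
    have hs : ∑ c, q (c - x) = ∑ c, q c := (Equiv.subRight x).sum_comp q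
    rw [← Finset.sum_div, hs, q_sum] at h
    linarith
  refine ⟨fun c => q c / 2 + r c, q, fun c => by linarith [q_nonneg c, r_nonneg c], q_nonneg,
    ?_, q_sum, ?_⟩
  · rw [Finset.sum_add_distrib, ← Finset.sum_div, q_sum, r_sum]
    norm_num
  · refine congrFun (resolvent_injective (l := 3) (a := 1) (b := 1) (by norm_num) (by norm_num)
      (by norm_num) y x fun c => ?_)
    have h0 := hβ c
    have h1 := hq c
    have h2 := hr c
    have h3 := hr (c - y)
    have e1 : c - (y + y) = c - y - y := by abel
    have e2 : c - x - y = c - y - x := by abel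
    rw [e1] at h1
    simp only [e2]
    have h4 : (if c = 0 then (2 : ℝ) else 0) = 2 * (if c = 0 then (1 : ℝ) else 0) := by
      split_ifs <;> norm_num
    rw [h4] at h1
    linarith

end Resolvent

section BlockIncrement

variable {N : ℕ}

/-- The number of words of length `k` in the letters `1`, `x` with sum `c`. -/
noncomputable def wordCount (x : ZMod N) (k : ℕ) (c : ZMod N) : ℝ :=
  ∑ a ∈ Finset.range (k + 1), (k.choose a : ℝ) *
    (if (a : ZMod N) + ((k - a : ℕ) : ZMod N) * x = c then 1 else 0)

theorem wordCount_zero (x c : ZMod N) : wordCount x 0 c = if c = 0 then 1 else 0 := by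
  simp [wordCount, eq_comm]

theorem wordCount_nonneg (x : ZMod N) (k : ℕ) (c : ZMod N) : 0 ≤ wordCount x k c :=
  Finset.sum_nonneg fun a _ => by split_ifs <;> simp

theorem wordCount_le (x : ZMod N) (k : ℕ) (c : ZMod N) : wordCount x k c ≤ 2 ^ k := by
  calc wordCount x k c ≤ ∑ a ∈ Finset.range (k + 1), (k.choose a : ℝ) :=
        Finset.sum_le_sum fun a _ => by split_ifs <;> simp
    _ = 2 ^ k := by exact_mod_cast Nat.sum_range_choose k

theorem wordCount_succ (x : ZMod N) (k : ℕ) (c : ZMod N) :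
    wordCount x (k + 1) c = wordCount x k (c - 1) + wordCount x k (c - x) := by
  have key : ∀ k c, wordCount x k c = ∑ ij ∈ Finset.HasAntidiagonal.antidiagonal k, (k.choose ij.1 : ℝ) *
      (if (ij.1 : ZMod N) + (ij.2 : ZMod N) * x = c then 1 else 0) := fun k c =>
    (Finset.Nat.sum_antidiagonal_eq_sum_range_succ (fun i j => (k.choose i : ℝ) *
      (if (i : ZMod N) + (j : ZMod N) * x = c then 1 else 0)) k).symm
  rw [key, key, key, Finset.sum_antidiagonal_choose_succ_mul
    (fun i j => if (i : ZMod N) + (j : ZMod N) * x = c then (1 : ℝ) else 0), add_comm]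
  congr 1
  · refine Finset.sum_congr rfl fun ij hij => ?_
    rw [Nat.choose_symm_of_eq_add (Finset.HasAntidiagonal.mem_antidiagonal.1 hij).symm]
    congr 1
    refine if_congr ?_ rfl rfl
    rw [eq_sub_iff_add_eq]
    push_cast
    ring_nf
  · refine Finset.sum_congr rfl fun ij _ => ?_
    congr 1
    refine if_congr ?_ rfl rfl
    rw [eq_sub_iff_add_eq]
    push_cast
    ring_nf

/-- The law of a block increment. -/
noncomputable def incrementLaw (x c : ZMod N) : ℝ :=
  ∑' k : ℕ, (1 / 3 : ℝ) * (1 / 3) ^ k * wordCount x k c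

theorem incrementLaw_nonneg (x c : ZMod N) : 0 ≤ incrementLaw x c :=
  tsum_nonneg fun k => mul_nonneg (by positivity) (wordCount_nonneg x k c)

theorem summable_incrementLaw (x c : ZMod N) :
    Summable fun k : ℕ => (1 / 3 : ℝ) * (1 / 3) ^ k * wordCount x k c := by
  refine Summable.of_nonneg_of_le (fun k => mul_nonneg (by positivity) (wordCount_nonneg x k c))
    (fun k => ?_) ((summable_geometric_of_lt_one (r := (2 / 3 : ℝ)) (by norm_num)
      (by norm_num)).mul_left (1 / 3))
  calc (1 / 3 : ℝ) * (1 / 3) ^ k * wordCount x k c ≤ 1 / 3 * (1 / 3) ^ k * 2 ^ k :=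
        mul_le_mul_of_nonneg_left (wordCount_le x k c) (by positivity)
    _ = 1 / 3 * (2 / 3) ^ k := by rw [mul_assoc, ← mul_pow]; norm_num

theorem incrementLaw_resolvent (x c : ZMod N) :
    3 * incrementLaw x c - incrementLaw x (c - 1) - incrementLaw x (c - x) =
      if c = 0 then 1 else 0 := by
  have h : incrementLaw x c = 1 / 3 * (if c = 0 then 1 else 0) +
      1 / 3 * (incrementLaw x (c - 1) + incrementLaw x (c - x)) := by
    unfold incrementLaw
    rw [(summable_incrementLaw x c).tsum_eq_zero_add,
      ← (summable_incrementLaw x (c - 1)).tsum_add (summable_incrementLaw x (c - x)),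
      ← tsum_mul_left, wordCount_zero]
    congr 1
    · ring
    · refine tsum_congr fun k => ?_
      rw [wordCount_succ]
      ring
  linarith

end BlockIncrement

section BlockWalk

theorem two_mul_injective {N : ℕ} (hodd : Odd N) : Function.Injective fun c : ZMod N => 2 * c := by
  have h : IsUnit (2 : ZMod N) := by
    exact_mod_cast (ZMod.isUnit_iff_coprime 2 N).2 (Nat.coprime_two_left.2 hodd)
  exact h.mul_right_injective

theorem blockMatrix_apply {N : ℕ} (hodd : Odd N) (x u c : ZMod N) :
    blockMatrix N x u (2 * (u + c)) = incrementLaw x c := by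
  refine tsum_congr fun k => ?_
  unfold wordCount
  congr 1
  refine Finset.sum_congr rfl fun a _ => ?_
  congr 1
  refine if_congr ?_ rfl rfl
  rw [(two_mul_injective hodd).eq_iff, add_assoc, add_right_inj]

variable {N : ℕ} [NeZero N]

theorem blockMatrix_mulVec (hodd : Odd N) (x u : ZMod N) (g : ZMod N → ℝ) :
    (blockMatrix N x).mulVec g u = ∑ c, incrementLaw x c * g (2 * (u + c)) := by
  have hb : Function.Bijective fun c : ZMod N => 2 * (u + c) :=
    Finite.injective_iff_bijective.1
      ((two_mul_injective hodd).comp (add_right_injective u))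
  simp only [Matrix.mulVec, dotProduct]
  rw [← hb.sum_comp fun v => blockMatrix N x u v * g v]
  exact Finset.sum_congr rfl fun c _ => by rw [blockMatrix_apply hodd]

theorem blockMatrix_mulVec_nonneg (hodd : Odd N) (x : ZMod N) {g : ZMod N → ℝ}
    (hg : ∀ v, 0 ≤ g v) (u : ZMod N) : 0 ≤ (blockMatrix N x).mulVec g u := by
  rw [blockMatrix_mulVec hodd]
  exact Finset.sum_nonneg fun c _ => mul_nonneg (incrementLaw_nonneg x c) (hg _)

theorem blockMatrix_mulVec_le (hodd : Odd N) (x : ZMod N) {g : ZMod N → ℝ} {K : ℝ}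
    (hg : ∀ v, g v ≤ K) (u : ZMod N) : (blockMatrix N x).mulVec g u ≤ K := by
  have hsum : ∑ c, incrementLaw x c = 1 := by
    have h := sum_resolvent 3 1 1 1 x (incrementLaw x)
    simp only [one_mul, incrementLaw_resolvent, Finset.sum_ite_eq', Finset.mem_univ,
      if_true] at h
    linarith
  rw [blockMatrix_mulVec hodd, ← one_mul K, ← hsum, Finset.sum_mul]
  exact Finset.sum_le_sum fun c _ => mul_le_mul_of_nonneg_left (hg _) (incrementLaw_nonneg x c)

theorem blockMatrix_mulVec_eq_split (hodd : Odd N) (x : ZMod N) :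
    ∃ p q : ZMod N → ℝ, (∀ c, 0 ≤ p c) ∧ (∀ c, 0 ≤ q c) ∧ ∑ c, p c = 1 / 3 ∧
      ∑ c, q c = 1 / 3 ∧ ∀ g u, (blockMatrix N x).mulVec g u =
        ∑ c, (q c * g (2 * (u + c)) + p c * (g (2 * (u + c)) + g (2 * (u + c) + 2))) := by
  obtain ⟨p, q, hp, hq, hps, hqs, h⟩ :=
    exists_fair_coin_decomposition 1 x (incrementLaw_resolvent x)
  refine ⟨p, q, hp, hq, hps, hqs, fun g u => ?_⟩
  have hshift : ∑ c, p (c - 1) * g (2 * (u + c)) = ∑ c, p c * g (2 * (u + c) + 2) := by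
    rw [← Equiv.sum_comp (Equiv.addRight (1 : ZMod N)) fun c => p (c - 1) * g (2 * (u + c))]
    refine Finset.sum_congr rfl fun c _ => ?_
    simp only [Equiv.coe_addRight, add_sub_cancel_right]
    congr 2
    ring
  rw [blockMatrix_mulVec hodd]
  simp only [h, add_mul, mul_add (p _), Finset.sum_add_distrib, hshift]
  ring

/-- One step of the block walk halves the length of the progressions of step `2` on which the
mass of a nonnegative function is controlled, and gains a factor `2 / 3`. -/
theorem sum_blockMatrix_mulVec_le (hodd : Odd N) (x : ZMod N) {g : ZMod N → ℝ}
    (hg : ∀ v, 0 ≤ g v) {n : ℕ} {K : ℝ}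
    (hK : ∀ w, ∑ i ∈ Finset.range (2 * n), g (w + 2 * (i : ZMod N)) ≤ K) (w : ZMod N) :
    ∑ i ∈ Finset.range n, (blockMatrix N x).mulVec g (w + 2 * (i : ZMod N)) ≤ 2 / 3 * K := by
  obtain ⟨p, q, hp, hq, hps, hqs, h⟩ := blockMatrix_mulVec_eq_split hodd x
  have hpair : ∀ (f : ℕ → ℝ) (n : ℕ), ∑ i ∈ Finset.range (2 * n), f i =
      ∑ i ∈ Finset.range n, (f (2 * i) + f (2 * i + 1)) := by
    intro f n
    induction n with
    | zero => simp
    | succ n ih => rw [Finset.sum_range_succ, ← ih, Nat.mul_succ, Finset.sum_range_succ,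
        Finset.sum_range_succ, add_assoc]
  have hboth : ∀ c, ∑ i ∈ Finset.range n, (g (2 * (w + 2 * (i : ZMod N) + c)) +
      g (2 * (w + 2 * (i : ZMod N) + c) + 2)) ≤ K := by
    intro c
    refine le_trans (le_of_eq ?_) (hK (2 * (w + c)))
    rw [hpair]
    refine Finset.sum_congr rfl fun i _ => ?_
    push_cast
    congr 2 <;> ring
  have hfst : ∀ c, ∑ i ∈ Finset.range n, g (2 * (w + 2 * (i : ZMod N) + c)) ≤ K := fun c =>
    (Finset.sum_le_sum fun i _ => le_add_of_nonneg_right (hg _)).trans (hboth c)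
  simp only [h]
  rw [Finset.sum_comm]
  calc _ ≤ ∑ c, (q c * K + p c * K) := by
        refine Finset.sum_le_sum fun c _ => ?_
        rw [Finset.sum_add_distrib, ← Finset.mul_sum, ← Finset.mul_sum]
        exact add_le_add (mul_le_mul_of_nonneg_left (hfst c) (hq c))
          (mul_le_mul_of_nonneg_left (hboth c) (hp c))
    _ = 2 / 3 * K := by
        rw [Finset.sum_add_distrib, ← Finset.sum_mul, ← Finset.sum_mul, hps, hqs]
        ring

theorem blockMatrix_pow_mulVec_le (hodd : Odd N) (x : ZMod N) (s : ℕ) {g : ZMod N → ℝ}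
    (hg : ∀ v, 0 ≤ g v) {K : ℝ}
    (hK : ∀ w, ∑ i ∈ Finset.range (2 ^ s), g (w + 2 * (i : ZMod N)) ≤ K) (u : ZMod N) :
    (blockMatrix N x ^ s).mulVec g u ≤ (2 / 3) ^ s * K := by
  induction s generalizing g K with
  | zero => simpa using hK u
  | succ s ih =>
    rw [pow_succ, ← Matrix.mulVec_mulVec, pow_succ, mul_assoc]
    refine ih (blockMatrix_mulVec_nonneg hodd x hg) (sum_blockMatrix_mulVec_le hodd x hg ?_)
    rwa [← pow_succ']

theorem blockMatrix_pow_apply_le (hodd : Odd N) (x : ZMod N) {s : ℕ} (hs : 2 ^ s ≤ N)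
    (u v : ZMod N) : (blockMatrix N x ^ s) u v ≤ (2 / 3) ^ s := by
  have h := blockMatrix_pow_mulVec_le hodd x s (g := Pi.single v 1) (K := 1)
    (fun w => by rw [Pi.single_apply]; split_ifs <;> norm_num) (fun w => ?_) u
  · simpa using h
  · simp only [Pi.single_apply, Finset.sum_boole]
    have hcard : (Finset.filter (fun i : ℕ => w + 2 * (i : ZMod N) = v)
        (Finset.range (2 ^ s))).card ≤ 1 := by
      refine Finset.card_le_one.2 fun i hi j hj => ?_
      simp only [Finset.mem_filter, Finset.mem_range] at hi hj
      have hij : (i : ZMod N) = j :=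
        two_mul_injective hodd (add_left_cancel (hi.2.trans hj.2.symm))
      rw [ZMod.natCast_eq_natCast_iff'] at hij
      rwa [Nat.mod_eq_of_lt (hi.1.trans_le hs), Nat.mod_eq_of_lt (hj.1.trans_le hs)] at hij
    exact_mod_cast hcard

theorem blockMatrix_pow_add_apply_le (hodd : Odd N) (x : ZMod N) {s : ℕ} {K : ℝ} {v : ZMod N}
    (h : ∀ u, (blockMatrix N x ^ s) u v ≤ K) (t : ℕ) (u : ZMod N) :
    (blockMatrix N x ^ (t + s)) u v ≤ K := by
  induction t generalizing u with
  | zero => simpa using h u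
  | succ t ih =>
    rw [add_right_comm, pow_succ']
    exact blockMatrix_mulVec_le hodd x ih u

end BlockWalk

theorem two_thirds_pow_log_le {N : ℕ} (hN : N ≠ 0) :
    (2 / 3 : ℝ) ^ Nat.log 2 N ≤ 3 / 2 * (N : ℝ) ^ ((1 : ℝ) - Real.logb 2 3) := by
  have hlog : (1 : ℝ) ≤ Real.logb 2 3 := by
    rw [Real.le_logb_iff_rpow_le (by norm_num) (by norm_num)]
    norm_num
  have h2 : (2 : ℝ) ^ ((1 : ℝ) - Real.logb 2 3) = 2 / 3 := by
    rw [Real.rpow_sub (by norm_num), Real.rpow_one,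
      Real.rpow_logb (by norm_num) (by norm_num) (by norm_num)]
  have hpow : ((2 : ℝ) ^ (Nat.log 2 N + 1)) ^ ((1 : ℝ) - Real.logb 2 3) =
      (2 / 3) ^ (Nat.log 2 N + 1) := by
    rw [← h2, ← Real.rpow_natCast, ← Real.rpow_natCast, ← Real.rpow_mul (by norm_num),
      ← Real.rpow_mul (by norm_num), mul_comm]
  have hle : (N : ℝ) ≤ 2 ^ (Nat.log 2 N + 1) := by
    exact_mod_cast (Nat.lt_pow_succ_log_self (by norm_num) N).le
  have h := Real.rpow_le_rpow_of_nonpos (z := (1 : ℝ) - Real.logb 2 3)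
    (by exact_mod_cast Nat.pos_of_ne_zero hN) hle (by linarith)
  rw [hpow, pow_succ] at h
  linarith

theorem rpow_one_sub_logb_le {N : ℝ} (hN : 1 ≤ N) :
    N ^ ((1 : ℝ) - Real.logb 2 3) ≤ 1 / √N := by
  have hlog : (3 / 2 : ℝ) ≤ Real.logb 2 3 := by
    have h : Real.logb 2 8 ≤ Real.logb 2 (3 ^ 2) :=
      Real.logb_le_logb_of_le (by norm_num) (by norm_num) (by norm_num)
    rw [Real.logb_pow, show (8 : ℝ) = 2 ^ 3 by norm_num, Real.logb_pow,
      Real.logb_self_eq_one (by norm_num)] at h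
    push_cast at h
    linarith
  calc N ^ ((1 : ℝ) - Real.logb 2 3) ≤ N ^ (-(1 / 2) : ℝ) :=
        Real.rpow_le_rpow_of_exponent_le hN (by linarith)
    _ = 1 / √N := by
        rw [Real.rpow_neg (by linarith), ← Real.sqrt_eq_rpow, one_div]

theorem block_walk_decay (N : ℕ) [NeZero N] (hN : 3 ≤ N) (hodd : Odd N) (x : ZMod N) :
    (∀ s : ℕ, 1 ≤ s → s ≤ Nat.log 2 N →
      ∀ u v : ZMod N, (blockMatrix N x ^ s) u v ≤ (2 / 3 : ℝ) ^ s) ∧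
    (∀ s : ℕ, Nat.log 2 N < s →
      ∀ u v : ZMod N,
        (blockMatrix N x ^ s) u v ≤ (3 / 2 : ℝ) * (N : ℝ) ^ ((1 : ℝ) - Real.logb 2 3) ∧
        (3 / 2 : ℝ) * (N : ℝ) ^ ((1 : ℝ) - Real.logb 2 3) ≤ (3 / 2) / Real.sqrt N) := by
  have hlog := Nat.pow_log_le_self 2 (NeZero.ne N)
  refine ⟨fun s _ hs u v => blockMatrix_pow_apply_le hodd x
    ((Nat.pow_le_pow_right two_pos hs).trans hlog) u v, fun s hs u v => ⟨?_, ?_⟩⟩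
  · rw [← Nat.sub_add_cancel hs.le]
    exact (blockMatrix_pow_add_apply_le hodd x
      (fun u => blockMatrix_pow_apply_le hodd x hlog u v) _ u).trans
      (two_thirds_pow_log_le (NeZero.ne N))
  · have h := rpow_one_sub_logb_le (N := N) (by exact_mod_cast (by omega : 1 ≤ N))
    calc _ ≤ 3 / 2 * (1 / √(N : ℝ)) := mul_le_mul_of_nonneg_left h (by norm_num)
      _ = _ := by ring
end

section
/- Let B be the block walk on Z_N (N ≥ 3 odd, parameter x ∈ Z_N), let m = ⌈log₂ N⌉, and let ε ∈ (0,1). If s ≥ ⌈ m·log( 2(m−1)/ε ) ⌉, then for every u,v ∈ Z_N, (1−ε)/N ≤ B^{2s}(u,v) ≤ (1+ε)/N. -/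
open Finset

/-- The characteristic function of one block increment: the value at `η` of the Fourier
transform of the law of `ε_1 + ⋯ + ε_M`. -/
noncomputable def blockChar {N : ℕ} [NeZero N] (x η : ZMod N) : ℂ :=
  (3 - ZMod.stdAddChar η - ZMod.stdAddChar (η * x))⁻¹

/-- `alternationWeight δ L k` is `δ` to the number of alternations among the `L + 1` lowest
binary digits of `k`. -/
noncomputable def alternationWeight (δ : ℝ) : ℕ → ℕ → ℝ
  | 0, _ => 1
  | L + 1, k => alternationWeight δ L (k / 2) * if k % 2 = k / 2 % 2 then 1 else δ

lemma summable_blockMatrix_term {N : ℕ} (x u v : ZMod N) :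
    Summable fun k : ℕ ↦ (1 / 3 : ℝ) * (1 / 3) ^ k *
      ∑ a ∈ Finset.range (k + 1), (k.choose a : ℝ) *
        (if 2 * (u + (a : ZMod N) + ((k - a : ℕ) : ZMod N) * x) = v then 1 else 0) := by
  refine Summable.of_nonneg_of_le (f := fun k : ℕ ↦ (1 / 3 : ℝ) * (2 / 3) ^ k) (fun k ↦ ?_)
    (fun k ↦ ?_) ((summable_geometric_of_lt_one (by norm_num) (by norm_num)).mul_left _)
  · have : ∀ a : ℕ, (0 : ℝ) ≤ (k.choose a : ℝ) *
        (if 2 * (u + (a : ZMod N) + ((k - a : ℕ) : ZMod N) * x) = v then 1 else 0) := by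
      intro a
      split_ifs <;> simp
    have := Finset.sum_nonneg fun a (_ : a ∈ Finset.range (k + 1)) ↦ this a
    positivity
  · have h : ∑ a ∈ Finset.range (k + 1), (k.choose a : ℝ) *
        (if 2 * (u + (a : ZMod N) + ((k - a : ℕ) : ZMod N) * x) = v then 1 else 0) ≤ 2 ^ k := by
      have h2 : ((2 : ℕ) ^ k : ℝ) = ∑ a ∈ Finset.range (k + 1), (k.choose a : ℝ) := by
        exact_mod_cast (Nat.sum_range_choose k).symm
      rw [Nat.cast_ofNat] at h2
      rw [h2]
      refine Finset.sum_le_sum fun a _ ↦ ?_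
      split_ifs <;> simp
    calc _ ≤ (1 / 3 : ℝ) * (1 / 3) ^ k * 2 ^ k := by gcongr
      _ = _ := by rw [mul_assoc, ← mul_pow]; norm_num

section Fourier

variable {N : ℕ} [NeZero N]

lemma norm_stdAddChar_add_le (η x : ZMod N) :
    ‖ZMod.stdAddChar η + ZMod.stdAddChar (η * x)‖ ≤ 2 := by
  refine (norm_add_le _ _).trans ?_
  simp only [AddChar.norm_apply]
  norm_num

lemma blockChar_zero (x : ZMod N) : blockChar x 0 = 1 := by
  simp [blockChar]
  norm_num

lemma norm_blockChar_le (x η : ZMod N) :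
    ‖blockChar x η‖ ≤ (2 - (ZMod.stdAddChar η : ℂ).re)⁻¹ := by
  have h1 : (ZMod.stdAddChar η : ℂ).re ≤ 1 :=
    (Complex.re_le_norm _).trans_eq (AddChar.norm_apply _ _)
  have h2 : (ZMod.stdAddChar (η * x) : ℂ).re ≤ 1 :=
    (Complex.re_le_norm _).trans_eq (AddChar.norm_apply _ _)
  rw [blockChar, norm_inv]
  apply inv_anti₀ (by linarith)
  refine le_trans ?_ (Complex.re_le_norm _)
  simp only [Complex.sub_re, Complex.re_ofNat]
  linarith

lemma norm_blockChar_le_one (x η : ZMod N) : ‖blockChar x η‖ ≤ 1 := by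
  have h1 : (ZMod.stdAddChar η : ℂ).re ≤ 1 :=
    (Complex.re_le_norm _).trans_eq (AddChar.norm_apply _ _)
  exact (norm_blockChar_le x η).trans (inv_le_one_of_one_le₀ (by linarith))

lemma stdAddChar_natCast_re (y : ℕ) :
    (ZMod.stdAddChar (y : ZMod N) : ℂ).re = Real.cos (2 * Real.pi * (y / N)) := by
  have h := ZMod.stdAddChar_coe (N := N) (y : ℤ)
  rw [Int.cast_natCast] at h
  rw [h, ← Complex.exp_ofReal_mul_I_re]
  congr 2
  push_cast
  ring

lemma norm_blockChar_le_half (x : ZMod N) (y : ℕ) (hy : 4 * y / N % 2 ≠ 4 * y / N / 2 % 2) :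
    ‖blockChar x (y : ZMod N)‖ ≤ 1 / 2 := by
  refine (norm_blockChar_le _ _).trans ?_
  rw [one_div]
  apply inv_anti₀ two_pos
  have hN : 0 < N := NeZero.pos N
  have hN' : (0 : ℝ) < N := by exact_mod_cast hN
  suffices h : Real.cos (2 * Real.pi * (y / N)) ≤ 0 by
    rw [stdAddChar_natCast_re]
    linarith
  obtain ⟨c, hc1, hc2⟩ : ∃ c, 4 * c + 1 ≤ 4 * y / N ∧ 4 * y / N < 4 * c + 3 :=
    ⟨4 * y / N / 4, by omega, by omega⟩
  rw [Nat.le_div_iff_mul_le hN] at hc1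
  rw [Nat.div_lt_iff_lt_mul hN] at hc2
  have h1 : (c : ℝ) + 1 / 4 ≤ y / N := by
    rw [le_div_iff₀ hN']
    have : ((4 * c + 1) * N : ℝ) ≤ 4 * y := by exact_mod_cast hc1
    linarith
  have h2 : (y / N : ℝ) ≤ c + 3 / 4 := by
    rw [div_le_iff₀ hN']
    have : (4 * y : ℝ) < (4 * c + 3) * N := by exact_mod_cast hc2
    linarith
  rw [← Real.cos_sub_nat_mul_two_pi _ c]
  have hpi := Real.pi_pos
  apply Real.cos_nonpos_of_pi_div_two_le_of_le <;> nlinarith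

lemma sum_blockMatrix_mul_stdAddChar (x ξ u : ZMod N) :
    ∑ v, (blockMatrix N x u v : ℂ) * ZMod.stdAddChar (v * ξ) =
      blockChar x (2 * ξ) * ZMod.stdAddChar (u * (2 * ξ)) := by
  have hs : ∀ v : ZMod N, Summable fun k : ℕ ↦ (((1 / 3 : ℝ) * (1 / 3) ^ k *
      ∑ a ∈ Finset.range (k + 1), (k.choose a : ℝ) *
        (if 2 * (u + (a : ZMod N) + ((k - a : ℕ) : ZMod N) * x) = v then 1 else 0) : ℝ) : ℂ)
          * ZMod.stdAddChar (v * ξ) := fun v ↦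
    (Complex.summable_ofReal.2 (summable_blockMatrix_term x u v)).mul_right _
  simp only [blockMatrix]
  simp_rw [Complex.ofReal_tsum, ← tsum_mul_right]
  rw [← Summable.tsum_finsetSum fun v _ ↦ hs v]
  set z : ℂ := ZMod.stdAddChar (2 * ξ) + ZMod.stdAddChar (2 * ξ * x) with hz
  have hterm : ∀ k : ℕ, ∑ v : ZMod N, (((1 / 3 : ℝ) * (1 / 3) ^ k *
      ∑ a ∈ Finset.range (k + 1), (k.choose a : ℝ) *
        (if 2 * (u + (a : ZMod N) + ((k - a : ℕ) : ZMod N) * x) = v then 1 else 0) : ℝ) : ℂ)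
          * ZMod.stdAddChar (v * ξ) =
      1 / 3 * ZMod.stdAddChar (u * (2 * ξ)) * (z / 3) ^ k := by
    intro k
    have hpow : z ^ k * ZMod.stdAddChar (u * (2 * ξ)) = ∑ a ∈ Finset.range (k + 1),
        (k.choose a : ℂ) *
          ZMod.stdAddChar (2 * (u + (a : ZMod N) + ((k - a : ℕ) : ZMod N) * x) * ξ) := by
      rw [hz, add_pow, Finset.sum_mul]
      refine Finset.sum_congr rfl fun a _ ↦ ?_
      have : 2 * (u + (a : ZMod N) + ((k - a : ℕ) : ZMod N) * x) * ξ =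
          a • (2 * ξ) + (k - a) • (2 * ξ * x) + u * (2 * ξ) := by
        simp only [nsmul_eq_mul]
        ring
      rw [this, AddChar.map_add_eq_mul, AddChar.map_add_eq_mul, AddChar.map_nsmul_eq_pow,
        AddChar.map_nsmul_eq_pow]
      ring
    have hswap : ∑ v : ZMod N, (∑ a ∈ Finset.range (k + 1), (k.choose a : ℂ) *
        (if 2 * (u + (a : ZMod N) + ((k - a : ℕ) : ZMod N) * x) = v then 1 else 0))
          * (ZMod.stdAddChar (v * ξ) : ℂ) = z ^ k * ZMod.stdAddChar (u * (2 * ξ)) := by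
      rw [hpow]
      simp_rw [Finset.sum_mul]
      rw [Finset.sum_comm]
      refine Finset.sum_congr rfl fun a _ ↦ ?_
      simp [mul_assoc]
    push_cast
    simp_rw [mul_assoc (1 / 3 * (1 / 3 : ℂ) ^ k)]
    rw [← Finset.mul_sum]
    have hcast : ∀ c : Prop, [Decidable c] → (((if c then 1 else 0 : ℝ)) : ℂ) =
      if c then 1 else 0 := by intro c _; split_ifs <;> simp
    simp_rw [hcast]
    rw [hswap, div_pow, div_pow]
    ring
  simp_rw [hterm]
  have hnorm : ‖z / 3‖ < 1 := by
    rw [norm_div]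
    have := norm_stdAddChar_add_le (2 * ξ) x
    rw [← hz] at this
    have h3 : ‖(3 : ℂ)‖ = 3 := by simp
    rw [h3]
    linarith
  rw [tsum_mul_left, tsum_geometric_of_norm_lt_one hnorm, blockChar, sub_sub, ← hz]
  have h1 : (1 - z / 3) = (3 - z) / 3 := by ring
  rw [h1, inv_div]
  ring

lemma sum_blockMatrix_pow_mul_stdAddChar (x : ZMod N) (n : ℕ) (ξ u : ZMod N) :
    ∑ v, ((blockMatrix N x ^ n) u v : ℂ) * ZMod.stdAddChar (v * ξ) =
      (∏ j ∈ Finset.range n, blockChar x (2 ^ (j + 1) * ξ)) *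
        ZMod.stdAddChar (u * (2 ^ n * ξ)) := by
  induction n generalizing ξ with
  | zero => simp [Matrix.one_apply, apply_ite Complex.ofReal, Finset.sum_ite_eq]
  | succ n ih =>
    simp only [pow_succ, Matrix.mul_apply, Complex.ofReal_sum, Complex.ofReal_mul, Finset.sum_mul]
    rw [Finset.sum_comm]
    simp_rw [mul_assoc, ← Finset.mul_sum, sum_blockMatrix_mul_stdAddChar]
    simp_rw [mul_left_comm _ (blockChar x (2 * ξ)), ← Finset.mul_sum]
    rw [ih, Finset.prod_range_succ']
    simp only [pow_zero, one_mul, pow_succ, mul_assoc]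
    ring

lemma card_mul_blockMatrix_pow (x : ZMod N) (n : ℕ) (u v : ZMod N) :
    (N : ℂ) * ((blockMatrix N x ^ n) u v : ℂ) =
      ∑ ξ : ZMod N, (∏ j ∈ Finset.range n, blockChar x (2 ^ (j + 1) * ξ)) *
        ZMod.stdAddChar (u * (2 ^ n * ξ)) * ZMod.stdAddChar (-(v * ξ)) := by
  simp_rw [← sum_blockMatrix_pow_mul_stdAddChar, Finset.sum_mul]
  rw [Finset.sum_comm]
  have h : ∀ w : ZMod N, ∑ ξ : ZMod N, ((blockMatrix N x ^ n) u w : ℂ) *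
      ZMod.stdAddChar (w * ξ) * ZMod.stdAddChar (-(v * ξ)) =
      if w = v then (N : ℂ) * ((blockMatrix N x ^ n) u w : ℂ) else 0 := by
    intro w
    have h1 : ∀ ξ : ZMod N, ((blockMatrix N x ^ n) u w : ℂ) *
      ZMod.stdAddChar (w * ξ) * ZMod.stdAddChar (-(v * ξ)) =
        ((blockMatrix N x ^ n) u w : ℂ) * ZMod.stdAddChar (ξ * (w - v)) := by
      intro ξ
      rw [mul_assoc, ← AddChar.map_add_eq_mul]
      congr 2
      ring
    simp_rw [h1]
    rw [← Finset.mul_sum, AddChar.sum_mulShift _ (ZMod.isPrimitive_stdAddChar N)]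
    simp only [sub_eq_zero, ZMod.card]
    split_ifs <;> simp [mul_comm]
  simp_rw [h]
  simp

lemma abs_card_mul_blockMatrix_pow_sub_one_le (x : ZMod N) (n : ℕ) (u v : ZMod N) :
    |N * (blockMatrix N x ^ n) u v - 1| ≤
      ∑ ξ ∈ (univ : Finset (ZMod N)).erase 0,
        ∏ j ∈ Finset.range n, ‖blockChar x (2 ^ (j + 1) * ξ)‖ := by
  have h := card_mul_blockMatrix_pow x n u v
  rw [← Finset.add_sum_erase _ _ (Finset.mem_univ 0)] at h
  simp only [mul_zero, blockChar_zero, Finset.prod_const_one, AddChar.map_zero_eq_one, neg_zero,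
    mul_one] at h
  rw [← Real.norm_eq_abs, ← Complex.norm_real]
  push_cast
  rw [h, add_sub_cancel_left]
  refine (norm_sum_le _ _).trans (Finset.sum_le_sum fun ξ _ ↦ ?_)
  simp [AddChar.norm_apply]

end Fourier

/-- A product of several functions is dominated in sum by the power of a single one, if they all
have the same power sum. -/
lemma sum_prod_le_sum_pow {α : Type*} (S : Finset α) (q : ℕ) (hq : 0 < q) (f : ℕ → α → ℝ)
    (hf : ∀ i a, 0 ≤ f i a) (T : ℝ) (hT : ∀ i, ∑ a ∈ S, f i a ^ q = T) :
    ∑ a ∈ S, ∏ i ∈ Finset.range q, f i a ≤ T := by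
  have hq' : (q : ℝ) ≠ 0 := by positivity
  have h : ∀ a, ∏ i ∈ Finset.range q, f i a ≤
      ∑ i ∈ Finset.range q, (q : ℝ)⁻¹ * f i a ^ q := by
    intro a
    have := Real.geom_mean_le_arith_mean_weighted (Finset.range q) (fun _ ↦ (q : ℝ)⁻¹)
      (fun i ↦ f i a ^ q) (fun _ _ ↦ by positivity) (by simp [hq'])
      (fun i _ ↦ pow_nonneg (hf i a) q)
    refine le_trans (Finset.prod_le_prod (fun i _ ↦ hf i a) fun i _ ↦ ?_) this
    rw [Real.pow_rpow_inv_natCast (hf i a) hq.ne']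
  calc _ ≤ ∑ a ∈ S, ∑ i ∈ Finset.range q, (q : ℝ)⁻¹ * f i a ^ q :=
        Finset.sum_le_sum fun a _ ↦ h a
    _ = T := by
        rw [Finset.sum_comm]
        simp_rw [← Finset.mul_sum, hT]
        simp [hq']

lemma prod_range_mul_eq_prod_prod {M : Type*} [CommMonoid M] (a : ℕ → M) (q L : ℕ) :
    ∏ j ∈ Finset.range (q * L), a j =
      ∏ i ∈ Finset.range q, ∏ j ∈ Finset.range L, a (i * L + j) := by
  induction q with
  | zero => simp
  | succ q ih => rw [Nat.succ_mul, Finset.prod_range_add, ih, Finset.prod_range_succ]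

lemma alternationWeight_nonneg {δ : ℝ} (hδ : 0 ≤ δ) (L k : ℕ) : 0 ≤ alternationWeight δ L k := by
  induction L generalizing k with
  | zero => simp [alternationWeight]
  | succ L ih =>
    rw [alternationWeight]
    have := ih (k / 2)
    split_ifs <;> positivity

lemma alternationWeight_zero (δ : ℝ) (L : ℕ) : alternationWeight δ L 0 = 1 := by
  induction L with
  | zero => rfl
  | succ L ih => simp [alternationWeight, ih]

lemma alternationWeight_two_pow_sub_one (δ : ℝ) (L : ℕ) :
    alternationWeight δ L (2 ^ (L + 1) - 1) = 1 := by
  induction L with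
  | zero => rfl
  | succ L ih =>
    have hp : 2 ^ (L + 1 + 1) = 2 * 2 ^ (L + 1) := by ring
    have hp' : 2 ^ (L + 1) = 2 * 2 ^ L := by ring
    have hpos : 0 < 2 ^ L := by positivity
    have h : (2 ^ (L + 1 + 1) - 1) / 2 = 2 ^ (L + 1) - 1 := by omega
    rw [alternationWeight, h, ih, if_pos (by omega), one_mul]

lemma sum_range_two_mul (g : ℕ → ℝ) (n : ℕ) :
    ∑ k ∈ Finset.range (2 * n), g k = ∑ k ∈ Finset.range n, (g (2 * k) + g (2 * k + 1)) := by
  induction n with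
  | zero => simp
  | succ n ih => rw [Nat.mul_succ, Finset.sum_range_succ, Finset.sum_range_succ, ih,
      Finset.sum_range_succ, add_assoc]

lemma sum_alternationWeight (δ : ℝ) (L : ℕ) :
    ∑ k ∈ Finset.range (2 ^ (L + 1)), alternationWeight δ L k = 2 * (1 + δ) ^ L := by
  induction L with
  | zero => simp [alternationWeight]
  | succ L ih =>
    rw [pow_succ' 2 (L + 1), sum_range_two_mul, pow_succ (1 + δ) L, ← mul_assoc, ← ih, Finset.sum_mul]
    refine Finset.sum_congr rfl fun k _ ↦ ?_
    have h1 : (2 * k) / 2 = k := by omega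
    have h2 : (2 * k + 1) / 2 = k := by omega
    rw [alternationWeight, alternationWeight, h1, h2]
    rcases Nat.mod_two_eq_zero_or_one k with h | h
    · rw [if_pos (by omega), if_neg (by omega)]
      ring
    · rw [if_neg (by omega), if_pos (by omega)]
      ring

section Digits

variable {N : ℕ} [NeZero N]

lemma prod_norm_blockChar_pow_le (x : ZMod N) (q L y : ℕ) :
    (∏ j ∈ Finset.range L, ‖blockChar x (2 ^ j * (y : ZMod N))‖) ^ q ≤
      alternationWeight ((1 / 2) ^ q) L (2 ^ (L + 1) * y / N) := by
  induction L with
  | zero => simp [alternationWeight]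
  | succ L ih =>
    have h1 : 2 ^ (L + 1 + 1) * y / N / 2 = 2 ^ (L + 1) * y / N := by
      rw [Nat.div_div_eq_div_mul, mul_comm N 2, pow_succ', mul_assoc,
        Nat.mul_div_mul_left _ _ two_pos]
    have h2 : 2 ^ (L + 1 + 1) * y = 4 * (2 ^ L * y) := by ring
    rw [Finset.prod_range_succ, mul_pow, alternationWeight, h1]
    refine mul_le_mul ih ?_ (by positivity) (alternationWeight_nonneg (by positivity) _ _)
    have hcast : (2 ^ L * (y : ZMod N)) = ((2 ^ L * y : ℕ) : ZMod N) := by push_cast; rfl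
    split_ifs with h
    · exact pow_le_one₀ (norm_nonneg _) (norm_blockChar_le_one _ _)
    · rw [hcast]
      refine pow_le_pow_left₀ (norm_nonneg _) (norm_blockChar_le_half x _ ?_) q
      rwa [← h1, h2] at h

lemma sum_alternationWeight_le {δ : ℝ} (hδ : 0 ≤ δ) (L : ℕ) (hL : N < 2 ^ (L + 1)) :
    ∑ ξ ∈ (univ : Finset (ZMod N)).erase 0, alternationWeight δ L (2 ^ (L + 1) * ξ.val / N) ≤
      2 * (1 + δ) ^ L - 2 := by
  have hN : 0 < N := NeZero.pos N
  set M := 2 ^ (L + 1) with hM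
  have hmono : StrictMono fun y : ℕ ↦ M * y / N := by
    refine strictMono_nat_of_lt_succ fun y ↦ ?_
    rw [Nat.lt_iff_add_one_le, Nat.le_div_iff_mul_le hN, add_mul, one_mul, mul_add, mul_one]
    exact add_le_add (Nat.div_mul_le_self _ _) hL.le
  have hinj : Set.InjOn (fun ξ : ZMod N ↦ M * ξ.val / N)
      ((univ : Finset (ZMod N)).erase 0 : Finset (ZMod N)) := fun a _ b _ hab ↦
    ZMod.val_injective N (hmono.injective hab)
  have hM2 : 2 ≤ M := by
    rw [hM, pow_succ]
    have : 0 < 2 ^ L := by positivity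
    omega
  have hsub : ((univ : Finset (ZMod N)).erase 0).image (fun ξ : ZMod N ↦ M * ξ.val / N) ⊆
      ((Finset.range M).erase 0).erase (M - 1) := by
    intro k hk
    simp only [Finset.mem_image, Finset.mem_erase, Finset.mem_univ, and_true,
      Finset.mem_range] at hk ⊢
    obtain ⟨ξ, hξ, rfl⟩ := hk
    have hpos : 0 < ξ.val := Nat.pos_of_ne_zero (by simpa [ZMod.val_eq_zero] using hξ)
    have hlt : ξ.val + 1 ≤ N := ξ.val_lt
    have h0 : 0 < M * ξ.val / N := by simpa using hmono hpos
    have h1 : M * ξ.val / N < M - 1 := by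
      rw [Nat.div_lt_iff_lt_mul hN]
      obtain ⟨K, hK⟩ : ∃ K, M = K + 1 := ⟨M - 1, by omega⟩
      rw [hK] at hL ⊢
      rw [Nat.add_sub_cancel]
      nlinarith
    omega
  rw [← Finset.sum_image (f := alternationWeight δ L) hinj]
  refine (Finset.sum_le_sum_of_subset_of_nonneg hsub
    fun k _ _ ↦ alternationWeight_nonneg hδ L k).trans ?_
  have e1 := Finset.add_sum_erase (Finset.range M) (alternationWeight δ L) (a := 0)
    (by simp; omega)
  have e2 := Finset.add_sum_erase ((Finset.range M).erase 0) (alternationWeight δ L) (a := M - 1)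
    (by simp; omega)
  rw [alternationWeight_zero, hM, sum_alternationWeight] at e1
  rw [hM, alternationWeight_two_pow_sub_one] at e2
  linarith

lemma sum_prod_norm_blockChar_le (hodd : Odd N) (x : ZMod N) (n q L : ℕ) (hq : 0 < q)
    (hn : q * L ≤ n) (hL : N < 2 ^ (L + 1)) :
    ∑ ξ ∈ (univ : Finset (ZMod N)).erase 0,
        ∏ j ∈ Finset.range n, ‖blockChar x (2 ^ (j + 1) * ξ)‖ ≤
      2 * (1 + (1 / 2) ^ q) ^ L - 2 := by
  set F : ZMod N → ℝ := fun ξ ↦ ∏ j ∈ Finset.range L, ‖blockChar x (2 ^ j * ξ)‖ with hF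
  have hF0 : ∀ ξ, 0 ≤ F ξ := fun ξ ↦ Finset.prod_nonneg fun _ _ ↦ norm_nonneg _
  have hunit : IsUnit (2 : ZMod N) := by
    have := (ZMod.isUnit_iff_coprime 2 N).2 (Nat.coprime_two_left.2 hodd)
    exact_mod_cast this
  calc _ ≤ ∑ ξ ∈ (univ : Finset (ZMod N)).erase 0,
        ∏ i ∈ Finset.range q, F (2 ^ (i * L + 1) * ξ) := by
        refine Finset.sum_le_sum fun ξ _ ↦ ?_
        obtain ⟨t, rfl⟩ := Nat.exists_eq_add_of_le hn
        rw [Finset.prod_range_add]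
        refine (mul_le_of_le_one_right (Finset.prod_nonneg fun _ _ ↦ norm_nonneg _)
          (Finset.prod_le_one (fun _ _ ↦ norm_nonneg _)
            fun _ _ ↦ norm_blockChar_le_one _ _)).trans_eq ?_
        rw [prod_range_mul_eq_prod_prod]
        refine Finset.prod_congr rfl fun i _ ↦ Finset.prod_congr rfl fun j _ ↦ ?_
        congr 2
        ring
    _ ≤ ∑ ξ ∈ (univ : Finset (ZMod N)).erase 0, F ξ ^ q := by
        refine sum_prod_le_sum_pow _ q hq (fun i ξ ↦ F (2 ^ (i * L + 1) * ξ))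
          (fun _ _ ↦ hF0 _) _ fun i ↦ ?_
        obtain ⟨c, hc⟩ := hunit.pow (i * L + 1)
        rw [← hc]
        refine Finset.sum_nbij' (fun ξ ↦ c * ξ) (fun ξ ↦ (c⁻¹ : (ZMod N)ˣ) * ξ) ?_ ?_ ?_ ?_ ?_ <;>
          simp
    _ ≤ ∑ ξ ∈ (univ : Finset (ZMod N)).erase 0,
        alternationWeight ((1 / 2) ^ q) L (2 ^ (L + 1) * ξ.val / N) := by
        refine Finset.sum_le_sum fun ξ _ ↦ ?_
        have := prod_norm_blockChar_pow_le x q L ξ.val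
        rwa [ZMod.natCast_zmod_val] at this
    _ ≤ _ := sum_alternationWeight_le (by positivity) L hL

end Digits

lemma add_half_le_mul_log_two {L : ℕ} (hL : 1 ≤ L) {r q : ℝ} (hr : Real.log (2 * L) ≤ r)
    (hq : 2 * (L + 1) * r - L + 1 ≤ q * L) : r + 1 / 2 ≤ q * Real.log 2 := by
  have hL' : (1 : ℝ) ≤ L := by exact_mod_cast hL
  have h2 := Real.log_two_gt_d9
  have hpow : ∀ k : ℕ, 2 ^ k ≤ 2 * L → k * Real.log 2 ≤ r := by
    intro k hk
    rw [← Real.log_pow]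
    refine le_trans (Real.log_le_log (by positivity) ?_) hr
    exact_mod_cast hk
  have key : (r + 1 / 2) * L ≤ (2 * (L + 1) * r - L + 1) * 0.693 := by
    have h1 := hpow 1 (by omega)
    by_cases hL2 : L < 2
    · obtain rfl : L = 1 := by omega
      norm_num at *
      linarith
    have h4 := hpow 2 (by omega)
    by_cases hL4 : L < 4
    · interval_cases L <;> norm_num at * <;> linarith
    have h8 := hpow 3 (by omega)
    by_cases hL8 : L < 8
    · interval_cases L <;> norm_num at * <;> linarith
    have h16 := hpow 4 (by omega)
    push_cast at h16
    by_cases hL16 : L < 16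
    · interval_cases L <;> norm_num at * <;> linarith
    have h32 := hpow 5 (by omega)
    push_cast at h32
    have : (16 : ℝ) ≤ L := by exact_mod_cast not_lt.1 hL16
    nlinarith
  have hqpos : 0 ≤ q := by
    have : 0 ≤ Real.log (2 * L) := Real.log_nonneg (by linarith)
    by_contra! h
    nlinarith
  have : (r + 1 / 2) * L ≤ (q * Real.log 2) * L := by
    have h := mul_nonneg (mul_nonneg hqpos (by linarith : (0 : ℝ) ≤ L))
      (by linarith : 0 ≤ Real.log 2 - 0.693)
    linarith
  exact le_of_mul_le_mul_right this (by linarith)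

lemma one_add_half_pow_pow_le {L q : ℕ} (hL : 1 ≤ L) {ε : ℝ} (hε0 : 0 < ε) (hε1 : ε < 1)
    (hq : Real.log (2 * L / ε) + 1 / 2 ≤ q * Real.log 2) :
    2 * (1 + (1 / 2 : ℝ) ^ q) ^ L - 2 ≤ ε := by
  have hL' : (1 : ℝ) ≤ L := by exact_mod_cast hL
  have hpos : 0 < 2 * L / ε := by positivity
  have hexp : 2 * L / ε * Real.exp (1 / 2) ≤ 2 ^ q := by
    have := Real.exp_le_exp.2 hq
    rwa [Real.exp_add, Real.exp_log hpos, ← Real.log_pow, Real.exp_log (by positivity)] at this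
  have hhalf : (8 / 5 : ℝ) ≤ Real.exp (1 / 2) := by
    have := Real.quadratic_le_exp_of_nonneg (x := 1 / 2) (by norm_num)
    norm_num at this ⊢
    linarith
  set δ : ℝ := (1 / 2) ^ q with hδ
  have hδpos : 0 < δ := by positivity
  have hδ2 : δ * 2 ^ q = 1 := by rw [hδ, ← mul_pow]; norm_num
  have hy : L * δ * (16 / 5) ≤ ε := by
    have h1 : 2 * L / ε * (8 / 5) ≤ 2 ^ q :=
      (mul_le_mul_of_nonneg_left hhalf hpos.le).trans hexp
    have h2 : 2 * L * (8 / 5) ≤ 2 ^ q * ε := by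
      have := mul_le_mul_of_nonneg_right h1 hε0.le
      calc _ = 2 * L / ε * (8 / 5) * ε := by field_simp
        _ ≤ _ := this
    nlinarith
  have hy0 : 0 ≤ L * δ := by positivity
  have h3 : (1 + δ) ^ L ≤ Real.exp (L * δ) := by
    rw [Real.exp_nat_mul]
    refine pow_le_pow_left₀ (by positivity) ?_ L
    linarith [Real.add_one_le_exp δ]
  have h4 := (abs_le.1 (Real.abs_exp_sub_one_sub_id_le (x := L * δ)
    (by rw [abs_of_nonneg hy0]; linarith))).2
  nlinarith

theorem block_walk_mixing (N : ℕ) [NeZero N] (hN : 3 ≤ N) (hodd : Odd N) (x : ZMod N)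
    (ε : ℝ) (hε0 : 0 < ε) (hε1 : ε < 1)
    (s : ℕ)
    (hs : ⌈(Nat.clog 2 N : ℝ) *
        Real.log (2 * ((Nat.clog 2 N : ℝ) - 1) / ε)⌉₊ ≤ s) :
    ∀ u v : ZMod N,
      (1 - ε) / N ≤ (blockMatrix N x ^ (2 * s)) u v ∧
      (blockMatrix N x ^ (2 * s)) u v ≤ (1 + ε) / N := by
  intro u v
  have hpow : N ≤ 2 ^ Nat.clog 2 N := Nat.le_pow_clog one_lt_two N
  obtain ⟨L, hLm⟩ : ∃ L, Nat.clog 2 N = L + 1 := by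
    refine ⟨Nat.clog 2 N - 1, (Nat.succ_pred_eq_of_pos (Nat.pos_of_ne_zero fun h ↦ ?_)).symm⟩
    rw [h] at hpow
    omega
  rw [hLm] at hpow hs
  have hL : 1 ≤ L := by
    by_contra! h
    obtain rfl : L = 0 := by omega
    omega
  have hlt : N < 2 ^ (L + 1) := by
    refine lt_of_le_of_ne hpow fun h ↦ ?_
    rw [h, pow_succ] at hodd
    exact (Nat.not_odd_iff_even.2 (even_two.mul_left _)) hodd
  have hL' : (1 : ℝ) ≤ L := by exact_mod_cast hL
  push_cast at hs
  rw [add_sub_cancel_right] at hs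
  set r := Real.log (2 * L / ε) with hr
  have hs' : (L + 1) * r ≤ s := (Nat.le_ceil _).trans (by exact_mod_cast hs)
  have hr1 : Real.log (2 * L) ≤ r :=
    Real.log_le_log (by positivity) (le_div_self (by positivity) hε0 hε1.le)
  have hr0 : 0 ≤ r := (Real.log_nonneg (by linarith)).trans hr1
  set q := 2 * s / L with hq
  have hq1 : 2 * s + 1 ≤ q * L + L := by
    have := Nat.lt_div_mul_add (a := 2 * s) hL
    rw [← hq] at this
    omega
  have hq2 : r + 1 / 2 ≤ q * Real.log 2 := by
    refine add_half_le_mul_log_two hL hr1 ?_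
    have : (2 * s + 1 : ℝ) ≤ q * L + L := by exact_mod_cast hq1
    linarith
  have hq0 : 0 < q := by
    refine Nat.pos_of_ne_zero fun h ↦ ?_
    rw [h] at hq2
    norm_num at hq2
    linarith
  have hbound := ((abs_card_mul_blockMatrix_pow_sub_one_le x (2 * s) u v).trans
    (sum_prod_norm_blockChar_le hodd x (2 * s) q L hq0 (Nat.div_mul_le_self _ _) hlt)).trans
    (one_add_half_pow_pow_le hL hε0 hε1 hq2)
  have hNpos : (0 : ℝ) < N := by positivity
  rw [abs_le] at hbound
  constructor
  · rw [div_le_iff₀ hNpos]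
    linarith
  · rw [le_div_iff₀ hNpos]
    linarith
end
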